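/- arXiv:2306.09530 — 2 statements merged into one kernel-verified Lean document; each statement's English description precedes it below -/
import Mathlib

section
/- Let d ≥ 1, m ≥ 2, and let u: (0,∞)×ℝ^d → [0,∞) be measurable such that: (a) for every t > 0 the measure μ_t := u(t,·)·Leb is a Borel probability measure on ℝ^d; (b) for every δ > 0, u is essentially bounded on (δ,∞)×ℝ^d; (c) for all 0 < s < t and all ζ ∈ C²_c(ℝ^d): ∫ζ dμ_t − ∫ζ dμ_s = ∫_s^t ∫_{ℝ^d} u(r,x)^m · Δζ(x) dx dr (i.e. u is a locally bounded distributional probability solution of the porous medium equation ∂_t u = Δ(u^m)). Define E(ρ) := (1/(m−1)) ∫_{ℝ^d} ((dρ/dLeb)(x))^m dx for Borel probability measures ρ on ℝ^d, where dρ/dLeb is the Radon–Nikodym derivative of the absolutely continuous part of ρ. Then there exists a Lebesgue-null set N ⊆ (0,∞) such that for every t ∈ (0,∞)∖N and every ζ ∈ C³_c(ℝ^d): the map τ ↦ ∫ζ dμ_τ is differentiable at τ = t, the map σ ↦ E( μ_t∘(Id + σ∇ζ)^{-1} ) is differentiable at σ = 0, and d/dτ (∫ζ dμ_τ)|_{τ=t}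 = − d/dσ E( μ_t∘(Id + σ∇ζ)^{-1} )|_{σ=0}. -/
open MeasureTheory Real Set

/-- The Laplacian of `ζ : ℝ^d → ℝ` at `x`: `Δζ(x) = Σ_i ∂²_{ii} ζ(x)`. -/
noncomputable def lapl {d : ℕ} (ζ : EuclideanSpace ℝ (Fin d) → ℝ)
    (x : EuclideanSpace ℝ (Fin d)) : ℝ :=
  ∑ i, fderiv ℝ (fun y => fderiv ℝ ζ y (EuclideanSpace.single i 1)) x
    (EuclideanSpace.single i 1)

/-- The gradient of `ζ : ℝ^d → ℝ` at `x`, as a vector in `ℝ^d`. -/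
noncomputable def gradVec {d : ℕ} (ζ : EuclideanSpace ℝ (Fin d) → ℝ)
    (x : EuclideanSpace ℝ (Fin d)) : EuclideanSpace ℝ (Fin d) :=
  (WithLp.equiv 2 (Fin d → ℝ)).symm fun i => fderiv ℝ ζ x (EuclideanSpace.single i 1)

/-- The energy `E(ρ) := (1/(m−1)) ∫ ((dρ/dLeb)(x))^m dx` of a measure `ρ` on `ℝ^d`, where
`dρ/dLeb` is the Radon–Nikodym derivative of the absolutely continuous part of `ρ`. -/
noncomputable def pmEnergy {d : ℕ} (m : ℝ) (ρ : Measure (EuclideanSpace ℝ (Fin d))) : ℝ :=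
  (1 / (m - 1)) * ∫ x, (ρ.rnDeriv volume x).toReal ^ m


section Aux

open Filter Topology

lemma aux_contDiff_det {d : ℕ} :
    ContDiff ℝ 1 (fun B : EuclideanSpace ℝ (Fin d) →L[ℝ] EuclideanSpace ℝ (Fin d) => B.det) := by
  have h : (fun B : EuclideanSpace ℝ (Fin d) →L[ℝ] EuclideanSpace ℝ (Fin d) => B.det) =
      fun B => ∑ p : Equiv.Perm (Fin d), Equiv.Perm.sign p •
        ∏ i, (B (EuclideanSpace.basisFun (Fin d) ℝ i)) (p i) := by
    funext B
    rw [ContinuousLinearMap.det, ← LinearMap.det_toMatrix (EuclideanSpace.basisFun (Fin d) ℝ).toBasis,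
      Matrix.det_apply]
    simp [LinearMap.toMatrix_apply]
  rw [h]
  refine ContDiff.sum fun p _ => ?_
  have : ContDiff ℝ 1 fun B : EuclideanSpace ℝ (Fin d) →L[ℝ] EuclideanSpace ℝ (Fin d) =>
      ∏ i, (B (EuclideanSpace.basisFun (Fin d) ℝ i)) (p i) := by
    refine contDiff_prod fun i _ => ?_
    have h2 : ContDiff ℝ 1 fun B : EuclideanSpace ℝ (Fin d) →L[ℝ] EuclideanSpace ℝ (Fin d) =>
      (EuclideanSpace.proj (p i) : EuclideanSpace ℝ (Fin d) →L[ℝ] ℝ)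
        (B (EuclideanSpace.basisFun (Fin d) ℝ i)) :=
      (EuclideanSpace.proj (p i) : EuclideanSpace ℝ (Fin d) →L[ℝ] ℝ).contDiff.comp
        (contDiff_id.clm_apply contDiff_const)
    exact h2
  simp only [Units.smul_def, zsmul_eq_mul]
  exact contDiff_const.mul this

lemma aux_hasDerivAt_det {d : ℕ}
    (A : EuclideanSpace ℝ (Fin d) →L[ℝ] EuclideanSpace ℝ (Fin d)) :
    HasDerivAt (fun σ : ℝ => (1 + σ • A).det) (LinearMap.trace ℝ _ A.toLinearMap) 0 := by
  set M := LinearMap.toMatrix (EuclideanSpace.basisFun (Fin d) ℝ).toBasis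
    (EuclideanSpace.basisFun (Fin d) ℝ).toBasis A.toLinearMap with hM
  have h : (fun σ : ℝ => (1 + σ • A).det) = fun σ => 1 + Matrix.trace M * σ +
      (Matrix.det (1 + (Polynomial.X : Polynomial ℝ) • M.map Polynomial.C)).divX.divX.eval σ * σ ^ 2 := by
    funext σ
    rw [← Matrix.det_one_add_smul, ContinuousLinearMap.det,
      ← LinearMap.det_toMatrix (EuclideanSpace.basisFun (Fin d) ℝ).toBasis]
    congr 1
    have : ((1 + σ • A : EuclideanSpace ℝ (Fin d) →L[ℝ] EuclideanSpace ℝ (Fin d)) :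
      EuclideanSpace ℝ (Fin d) →ₗ[ℝ] EuclideanSpace ℝ (Fin d)) = LinearMap.id + σ • A.toLinearMap := rfl
    rw [this, map_add, map_smul, LinearMap.toMatrix_id]
  rw [h, LinearMap.trace_eq_matrix_trace ℝ (EuclideanSpace.basisFun (Fin d) ℝ).toBasis, ← hM]
  have h1 : HasDerivAt (fun σ : ℝ => 1 + Matrix.trace M * σ) (Matrix.trace M) 0 := by
    simpa using ((hasDerivAt_id (0:ℝ)).const_mul (Matrix.trace M)).const_add 1
  have h2 := ((Matrix.det (1 + (Polynomial.X : Polynomial ℝ) • M.map Polynomial.C)).divX.divX.hasDerivAt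
    (0:ℝ)).mul (hasDerivAt_pow 2 (0:ℝ))
  refine (h1.add h2).congr_deriv ?_
  simp

/-- pushforward energy formula -/
lemma aux_energy {d : ℕ} (m : ℝ) (hm : 2 ≤ m) (v : EuclideanSpace ℝ (Fin d) → ℝ)
    (hv : Measurable v) (hv0 : ∀ x, 0 ≤ v x)
    (T : EuclideanSpace ℝ (Fin d) → EuclideanSpace ℝ (Fin d))
    (T' : EuclideanSpace ℝ (Fin d) → EuclideanSpace ℝ (Fin d) →L[ℝ] EuclideanSpace ℝ (Fin d))
    (hT : ∀ x, HasFDerivAt T (T' x) x) (hT' : Continuous T')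
    (hinj : Function.Injective T) (hdet : ∀ x, 0 < (T' x).det) :
    pmEnergy m (Measure.map T (volume.withDensity fun x => ENNReal.ofReal (v x))) =
      (1 / (m - 1)) * ∫ x, v x ^ m * (T' x).det ^ (1 - m) := by
  have hTm : Measurable T := (continuous_iff_continuousAt.2 fun x => (hT x).continuousAt).measurable
  have hme : MeasurableEmbedding T := by
    exact (continuous_iff_continuousAt.2 fun x => (hT x).continuousAt).measurableEmbedding hinj
  have hdetm : Measurable fun x => (T' x).det :=
    (ContinuousLinearMap.continuous_det.comp hT').measurable
  set g : EuclideanSpace ℝ (Fin d) → ℝ := Function.extend T (fun x => v x / (T' x).det) 0 with hg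
  have hgm : Measurable g := hme.measurable_extend (hv.div hdetm) measurable_const
  have hgT : ∀ x, g (T x) = v x / (T' x).det := fun x => hinj.extend_apply _ _ _
  have hgout : ∀ y, y ∉ range T → g y = 0 := fun y hy => by
    rw [hg, Function.extend_apply' _ _ _ (by simpa using hy)]; rfl
  have hmap : Measure.map T (volume.withDensity fun x => ENNReal.ofReal (v x)) =
      volume.withDensity fun y => ENNReal.ofReal (g y) := by
    ext A hA
    rw [Measure.map_apply hTm hA, withDensity_apply _ (hTm hA), withDensity_apply _ hA]
    have h1 : ∫⁻ y in A, ENNReal.ofReal (g y) = ∫⁻ y in T '' (T ⁻¹' A), ENNReal.ofReal (g y) := by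
      rw [image_preimage_eq_inter_range]
      rw [← lintegral_indicator hA, ← lintegral_indicator (hA.inter hme.measurableSet_range)]
      congr 1; funext y
      by_cases hy : y ∈ range T
      · by_cases hyA : y ∈ A <;> simp [hy, hyA, indicator]
      · simp [indicator, hy, hgout y hy]
    rw [h1, lintegral_image_eq_lintegral_abs_det_fderiv_mul volume (hTm hA)
      (fun x _ => (hT x).hasFDerivWithinAt) hinj.injOn]
    refine lintegral_congr fun x => ?_
    rw [hgT, ← ENNReal.ofReal_mul (abs_nonneg _), abs_of_pos (hdet x)]
    congr 1
    have := (hdet x).ne'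
    field_simp
  have hg0 : ∀ y, 0 ≤ g y := fun y => by
    by_cases hy : y ∈ range T
    · obtain ⟨x, rfl⟩ := hy
      rw [hgT]; exact div_nonneg (hv0 x) (hdet x).le
    · exact (hgout y hy).ge
  rw [pmEnergy, hmap]
  congr 1
  have h2 : ∫ y, ((volume.withDensity fun y => ENNReal.ofReal (g y)).rnDeriv volume y).toReal ^ m
      = ∫ y, g y ^ m := by
    refine integral_congr_ae ?_
    filter_upwards [Measure.rnDeriv_withDensity volume hgm.ennreal_ofReal] with y hy
    rw [hy, ENNReal.toReal_ofReal (hg0 y)]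
  rw [h2]
  have h3 : ∫ y, g y ^ m = ∫ y in T '' univ, g y ^ m := by
    rw [image_univ]
    refine (setIntegral_eq_integral_of_forall_compl_eq_zero fun y hy => ?_).symm
    rw [hgout y hy, Real.zero_rpow (by linarith)]
  rw [h3, integral_image_eq_integral_abs_det_fderiv_smul volume MeasurableSet.univ
      (fun x _ => (hT x).hasFDerivWithinAt) hinj.injOn, setIntegral_univ]
  refine integral_congr_ae (Eventually.of_forall fun x => ?_)
  simp only [smul_eq_mul]
  rw [hgT, abs_of_pos (hdet x), Real.div_rpow (hv0 x) (hdet x).le, Real.rpow_sub (hdet x),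
    Real.rpow_one]
  ring

lemma aux_energy_deriv {d : ℕ} (m : ℝ) (hm : 2 ≤ m) (v : EuclideanSpace ℝ (Fin d) → ℝ)
    (hv : Measurable v) (hv0 : ∀ x, 0 ≤ v x) (hvm : Integrable fun x => v x ^ m)
    (ζ : EuclideanSpace ℝ (Fin d) → ℝ) (hζ : ContDiff ℝ 3 ζ) (hc : HasCompactSupport ζ) :
    HasDerivAt (fun σ : ℝ => pmEnergy m
      (Measure.map (fun x => x + σ • gradVec ζ x)
        (volume.withDensity fun x => ENNReal.ofReal (v x)))) (-∫ x, v x ^ m * lapl ζ x) 0 := by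
  have hζ' : ContDiff ℝ 2 (fderiv ℝ ζ) := hζ.fderiv_right (by norm_num)
  have hφ : ContDiff ℝ 2 (gradVec ζ) := by
    rw [contDiff_euclidean]
    intro i
    exact hζ'.clm_apply contDiff_const
  have hφc : HasCompactSupport (gradVec ζ) := by
    have := (hc.fderiv (𝕜 := ℝ)).comp_left (g := fun L : EuclideanSpace ℝ (Fin d) →L[ℝ] ℝ =>
      (WithLp.equiv 2 (Fin d → ℝ)).symm fun i => L (EuclideanSpace.single i 1)) (by
        ext i; simp)
    exact this
  have hφd : Differentiable ℝ (gradVec ζ) := hφ.differentiable (by norm_num)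
  set A := fderiv ℝ (gradVec ζ) with hA
  have hAcont : Continuous A := hφ.continuous_fderiv (by norm_num)
  have hAc : HasCompactSupport A := hφc.fderiv (𝕜 := ℝ)
  have htr : ∀ x, LinearMap.trace ℝ _ (A x).toLinearMap = lapl ζ x := by
    intro x
    rw [LinearMap.trace_eq_sum_inner _ (EuclideanSpace.basisFun (Fin d) ℝ), lapl]
    refine Finset.sum_congr rfl fun i _ => ?_
    have h1 : HasFDerivAt (fun y => fderiv ℝ ζ y (EuclideanSpace.single i 1))
        ((EuclideanSpace.proj i : EuclideanSpace ℝ (Fin d) →L[ℝ] ℝ).comp (A x)) x :=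
      (EuclideanSpace.proj i : EuclideanSpace ℝ (Fin d) →L[ℝ] ℝ).hasFDerivAt.comp x
        (hφd x).hasFDerivAt
    rw [h1.fderiv]
    simp [EuclideanSpace.basisFun_apply, EuclideanSpace.inner_single_left]
  obtain ⟨C₀, hC₀⟩ := hAc.exists_bound_of_continuous hAcont
  set C := max C₀ 1 with hCdef
  have hC1 : 1 ≤ C := le_max_right _ _
  have hCpos : 0 < C := by linarith
  have hC : ∀ x, ‖A x‖ ≤ C := fun x => (hC₀ x).trans (le_max_left _ _)
  set H : (EuclideanSpace ℝ (Fin d) →L[ℝ] EuclideanSpace ℝ (Fin d)) → ℝ :=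
    fun B => (1 + B).det ^ (1 - m) with hH
  have hdet1 : (1 + 0 : EuclideanSpace ℝ (Fin d) →L[ℝ] EuclideanSpace ℝ (Fin d)).det = 1 := by
    rw [add_zero, ContinuousLinearMap.det]; exact LinearMap.det_id
  have hdetC : ContDiff ℝ 1 fun B : EuclideanSpace ℝ (Fin d) →L[ℝ] EuclideanSpace ℝ (Fin d) =>
      (1 + B).det := aux_contDiff_det.comp (contDiff_const.add contDiff_id)
  have hHC : ContDiffAt ℝ 1 H 0 :=
    hdetC.contDiffAt.rpow_const_of_ne (by rw [hdet1]; exact one_ne_zero)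
  have hz : ∀ x, (0:ℝ) • A x = 0 := fun x => zero_smul ℝ (A x)
  have hsub : ∀ (a b : ℝ) x, a • A x - b • A x = (a - b) • A x := fun a b x =>
    (sub_smul a b (A x)).symm
  obtain ⟨K, t, ht, hL⟩ := hHC.exists_lipschitzOnWith
  have hpos : ∀ᶠ B in 𝓝 (0 : EuclideanSpace ℝ (Fin d) →L[ℝ] EuclideanSpace ℝ (Fin d)),
      0 < (1 + B).det :=
    hdetC.continuous.continuousAt.eventually (lt_mem_nhds (by beta_reduce; rw [hdet1]; exact one_pos))
  obtain ⟨r, hr, hrt⟩ := Metric.mem_nhds_iff.1 (inter_mem ht hpos)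
  set ε := min r 1 / C with hε
  have hεpos : 0 < ε := by positivity
  have hσr : ∀ σ ∈ Metric.ball (0:ℝ) ε, ∀ x, σ • A x ∈ Metric.ball
      (0 : EuclideanSpace ℝ (Fin d) →L[ℝ] EuclideanSpace ℝ (Fin d)) r := by
    intro σ hσ x
    rw [mem_ball_zero_iff] at hσ ⊢
    rw [norm_smul]
    calc ‖σ‖ * ‖A x‖ ≤ ‖σ‖ * C := by gcongr; exact hC x
      _ < ε * C := by gcongr
      _ = min r 1 := by rw [hε]; field_simp
      _ ≤ r := min_le_left _ _
  have hE : (fun σ : ℝ => pmEnergy m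
      (Measure.map (fun x => x + σ • gradVec ζ x)
        (volume.withDensity fun x => ENNReal.ofReal (v x)))) =ᶠ[𝓝 0]
      fun σ => (1 / (m - 1)) * ∫ x, v x ^ m * H (σ • A x) := by
    filter_upwards [Metric.ball_mem_nhds (0:ℝ) hεpos] with σ hσ
    refine aux_energy m hm v hv hv0 (fun x => x + σ • gradVec ζ x) (fun x => 1 + σ • A x) ?_ ?_ ?_ ?_
    · intro x
      exact (hasFDerivAt_id x).add ((hφd x).hasFDerivAt.const_smul σ)
    · exact continuous_const.add (hAcont.const_smul σ)
    · intro x y hxy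
      have hlip : LipschitzWith ⟨C, hCpos.le⟩ (gradVec ζ) :=
        lipschitzWith_of_nnnorm_fderiv_le hφd fun x => hC x
      have h1 := hlip.norm_sub_le y x
      have h2 : x - y = σ • (gradVec ζ y - gradVec ζ x) := by
        rw [smul_sub]
        have : x + σ • gradVec ζ x = y + σ • gradVec ζ y := hxy
        rw [sub_eq_sub_iff_add_eq_add, this, add_comm]
      have h3 : ‖σ‖ * C < 1 := by
        rw [mem_ball_zero_iff] at hσ
        calc ‖σ‖ * C < ε * C := by gcongr
          _ = min r 1 := by rw [hε]; field_simp
          _ ≤ 1 := min_le_right _ _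
      have h4 : ‖x - y‖ ≤ (‖σ‖ * C) * ‖x - y‖ := by
        conv_lhs => rw [h2, norm_smul]
        rw [mul_assoc, norm_sub_rev x y]
        gcongr
        exact h1
      have h5 : ‖x - y‖ = 0 := by
        by_contra hne
        have : 0 < ‖x - y‖ := lt_of_le_of_ne (norm_nonneg _) (Ne.symm hne)
        nlinarith
      exact sub_eq_zero.1 (norm_eq_zero.1 h5)
    · intro x
      exact (hrt (hσr σ hσ x)).2
  refine HasDerivAt.congr_of_eventuallyEq ?_ hE
  have hHm : Measurable H := by
    exact hdetC.continuous.measurable.pow_const _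
  have hH0 : H 0 = 1 := by simp only [hH]; rw [hdet1, Real.one_rpow]
  have hmain := hasDerivAt_integral_of_dominated_loc_of_lip (μ := volume)
    (F := fun (σ : ℝ) x => v x ^ m * H (σ • A x)) (x₀ := (0:ℝ))
    (F' := fun x => v x ^ m * ((1 - m) * lapl ζ x))
    (bound := fun x => (K * C) * v x ^ m)
    (Metric.ball_mem_nhds (0:ℝ) hεpos) ?_ ?_ ?_ ?_ ?_ ?_
  · refine (hmain.2.const_mul (1 / (m - 1))).congr_deriv ?_
    have : ∀ x, v x ^ m * ((1 - m) * lapl ζ x) = (1 - m) * (v x ^ m * lapl ζ x) := fun x => by ring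
    simp only [this]
    rw [integral_const_mul]
    have : m - 1 ≠ 0 := by linarith
    field_simp
    ring
  · refine Eventually.of_forall fun σ => Measurable.aestronglyMeasurable ?_
    exact (hv.pow_const m).mul (hHm.comp (hAcont.const_smul σ).measurable)
  · simpa [hz, hH0] using hvm
  · refine Measurable.aestronglyMeasurable ?_
    refine (hv.pow_const m).mul (measurable_const.mul ?_)
    have : lapl ζ = fun x => LinearMap.trace ℝ _ (A x).toLinearMap := by
      funext x; rw [htr]
    refine Finset.measurable_sum _ fun i _ => ?_
    exact (measurable_fderiv_apply_const ℝ _ _)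
  · refine Eventually.of_forall fun x => LipschitzOnWith.of_dist_le_mul fun a ha b hb => ?_
    have h1 := hL.dist_le_mul _ (hrt (hσr a ha x)).1 _ (hrt (hσr b hb x)).1
    have hvx : 0 ≤ v x ^ m := Real.rpow_nonneg (hv0 x) m
    rw [Real.coe_nnabs, abs_of_nonneg (by positivity)]
    rw [dist_eq_norm, dist_eq_norm] at *
    rw [← mul_sub, norm_mul, Real.norm_of_nonneg hvx]
    rw [hsub, norm_smul] at h1
    calc v x ^ m * ‖H (a • A x) - H (b • A x)‖ ≤ v x ^ m * (K * (‖a - b‖ * C)) := by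
          gcongr
          refine h1.trans ?_
          gcongr
          exact hC x
      _ = _ := by ring
  · exact hvm.const_mul _
  · refine Eventually.of_forall fun x => HasDerivAt.const_mul _ ?_
    have h1 := (aux_hasDerivAt_det (A x)).rpow_const (p := 1 - m) (Or.inl (by
      rw [hz, hdet1]; exact one_ne_zero))
    refine h1.congr_deriv ?_
    rw [hz, hdet1, Real.one_rpow, htr]
    ring

/-- Lebesgue points, uniformly in the test function. -/
lemma aux_time {d : ℕ} (w : ℝ → EuclideanSpace ℝ (Fin d) → ℝ)
    (hw : Measurable (Function.uncurry w)) (M : ℝ) (hM : 0 ≤ M)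
    (hb : ∀ᵐ r : ℝ, ∀ᵐ x, ‖w r x‖ ≤ M) :
    ∀ᵐ t : ℝ, ∀ g : EuclideanSpace ℝ (Fin d) → ℝ, Integrable g →
      ∀ c, HasDerivAt (fun τ => ∫ r in c..τ, ∫ x, w r x * g x) (∫ x, w t x * g x) t := by
  have : Fact ((1 : ENNReal) ≠ ⊤) := ⟨ENNReal.one_ne_top⟩
  have : TopologicalSpace.SeparableSpace (Lp ℝ 1 (volume : Measure (EuclideanSpace ℝ (Fin d)))) :=
    inferInstance
  have hwr : ∀ r, Measurable (w r) := fun r => hw.comp measurable_prodMk_left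
  have hint : ∀ r, (∀ᵐ x, ‖w r x‖ ≤ M) → ∀ g : EuclideanSpace ℝ (Fin d) → ℝ, Integrable g →
      Integrable fun x => w r x * g x := by
    intro r hr g hg
    exact hg.bdd_mul (hwr r).aestronglyMeasurable hr
  have hbound : ∀ r, (∀ᵐ x, ‖w r x‖ ≤ M) → ∀ g : EuclideanSpace ℝ (Fin d) → ℝ, Integrable g →
      ‖∫ x, w r x * g x‖ ≤ M * ∫ x, ‖g x‖ := by
    intro r hr g hg
    rw [← integral_const_mul]
    refine norm_integral_le_of_norm_le (hg.norm.const_mul M) ?_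
    filter_upwards [hr] with x hx
    rw [norm_mul]
    gcongr
  have hli : ∀ g : EuclideanSpace ℝ (Fin d) → ℝ, Integrable g →
      LocallyIntegrable (fun r => ∫ x, w r x * g x) := by
    intro g hg
    have hmeas : AEStronglyMeasurable (fun r : ℝ => ∫ x, w r x * g x) volume := by
      refine AEStronglyMeasurable.integral_prod_right' (f := fun p : ℝ × EuclideanSpace ℝ (Fin d) =>
        w p.1 p.2 * g p.2) ?_
      exact hw.aestronglyMeasurable.mul hg.aestronglyMeasurable.comp_snd
    refine (locallyIntegrable_const (M * ∫ x, ‖g x‖)).mono hmeas ?_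
    filter_upwards [hb] with r hr
    exact (hbound r hr g hg).trans (le_abs_self _)
  have hde : ∀ᵐ t : ℝ, ∀ n : ℕ, ∀ c, HasDerivAt (fun τ => ∫ r in c..τ, ∫ x, w r x *
      (TopologicalSpace.denseSeq (Lp ℝ 1 (volume : Measure (EuclideanSpace ℝ (Fin d)))) n) x)
      (∫ x, w t x *
      (TopologicalSpace.denseSeq (Lp ℝ 1 (volume : Measure (EuclideanSpace ℝ (Fin d)))) n) x) t := by
    rw [ae_all_iff]
    intro n
    exact LocallyIntegrable.ae_hasDerivAt_integral (hli _ (L1.integrable_coeFn _))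
  filter_upwards [hde, hb] with t hde ht g hg c
  rw [hasDerivAt_iff_isLittleO, Asymptotics.isLittleO_iff]
  intro ε hε
  obtain ⟨n, hn⟩ := (TopologicalSpace.denseRange_denseSeq
    (Lp ℝ 1 (volume : Measure (EuclideanSpace ℝ (Fin d))))).exists_dist_lt hg.toL1
      (show 0 < ε / (4 * (M + 1)) by positivity)
  set f := TopologicalSpace.denseSeq (Lp ℝ 1 (volume : Measure (EuclideanSpace ℝ (Fin d)))) n with hf
  have hfi : Integrable f := L1.integrable_coeFn f
  have hdiff : ∫ x, ‖g x - f x‖ ≤ ε / (4 * (M + 1)) := by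
    rw [dist_eq_norm, L1.norm_eq_integral_norm] at hn
    refine le_trans (le_of_eq ?_) hn.le
    refine integral_congr_ae ?_
    filter_upwards [Lp.coeFn_sub (hg.toL1 g) f, hg.coeFn_toL1] with x h1 h2
    rw [h1, Pi.sub_apply, h2]
  have hMd : M * ∫ x, ‖g x - f x‖ ≤ ε / 4 := by
    calc M * ∫ x, ‖g x - f x‖ ≤ (M + 1) * (ε / (4 * (M + 1))) := by
          gcongr
          linarith
      _ = ε / 4 := by field_simp
  have key : ∀ r, (∀ᵐ x, ‖w r x‖ ≤ M) →
      ‖(∫ x, w r x * g x) - ∫ x, w r x * f x‖ ≤ ε / 4 := by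
    intro r hr
    rw [← integral_sub (hint r hr g hg) (hint r hr f hfi)]
    have := hbound r hr _ (hg.sub hfi)
    simp only [Pi.sub_apply, mul_sub] at this
    exact this.trans hMd
  have hII : ∀ g : EuclideanSpace ℝ (Fin d) → ℝ, Integrable g → ∀ a b,
      IntervalIntegrable (fun r => ∫ x, w r x * g x) volume a b := fun g hg a b =>
    ((hli g hg).integrableOn_isCompact isCompact_uIcc).intervalIntegrable
  have h1 := hasDerivAt_iff_isLittleO.1 (hde n c)
  rw [Asymptotics.isLittleO_iff] at h1
  filter_upwards [h1 (show 0 < ε / 2 by positivity)] with τ hτ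
  rw [intervalIntegral.integral_interval_sub_left (hII _ hfi _ _) (hII _ hfi _ _)] at hτ
  rw [intervalIntegral.integral_interval_sub_left (hII _ hg _ _) (hII _ hg _ _)]
  have h2 : ‖(∫ r in t..τ, ∫ x, w r x * g x) - ∫ r in t..τ, ∫ x, w r x * f x‖ ≤
      ε / 4 * ‖τ - t‖ := by
    rw [← intervalIntegral.integral_sub (hII _ hg _ _) (hII _ hfi _ _)]
    refine intervalIntegral.norm_integral_le_of_norm_le_const_ae ?_
    filter_upwards [hb] with r hr _
    exact key r hr
  have h3 : ‖(τ - t) • (∫ x, w t x * f x) - (τ - t) • (∫ x, w t x * g x)‖ ≤ ε / 4 * ‖τ - t‖ := by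
    rw [← smul_sub, norm_smul, mul_comm]
    gcongr
    rw [norm_sub_rev]
    exact key t ht
  have h4 := norm_add₃_le (a := (∫ r in t..τ, ∫ x, w r x * g x) - ∫ r in t..τ, ∫ x, w r x * f x)
    (b := (∫ r in t..τ, ∫ x, w r x * f x) - (τ - t) • (∫ x, w t x * f x))
    (c := (τ - t) • (∫ x, w t x * f x) - (τ - t) • (∫ x, w t x * g x))
  have h5 : (∫ r in t..τ, ∫ x, w r x * g x) - (τ - t) • (∫ x, w t x * g x) =
    ((∫ r in t..τ, ∫ x, w r x * g x) - ∫ r in t..τ, ∫ x, w r x * f x) +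
    ((∫ r in t..τ, ∫ x, w r x * f x) - (τ - t) • (∫ x, w t x * f x)) +
    ((τ - t) • (∫ x, w t x * f x) - (τ - t) • (∫ x, w t x * g x)) := by abel
  rw [h5]
  linarith

end Aux

/-- Let `d ≥ 1`, `m ≥ 2`, and let `u ≥ 0` be a locally bounded
distributional probability solution of the porous medium equation `∂_t u = Δ(u^m)` in the
sense (a)–(c). With `E(ρ) := (1/(m−1)) ∫ ((dρ/dLeb))^m dx`, there is a Lebesgue-null set
`N ⊆ (0,∞)` such that for all `t ∈ (0,∞)∖N` and all `ζ ∈ C³_c(ℝ^d)`: `τ ↦ ∫ζ dμ_τ` is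
differentiable at `t`, `σ ↦ E(μ_t∘(Id + σ∇ζ)⁻¹)` is differentiable at `0`, and
`d/dτ(∫ζ dμ_τ)|_{τ=t} = −d/dσ E(μ_t∘(Id + σ∇ζ)⁻¹)|_{σ=0}`. -/
theorem stmt_16 (d : ℕ) (hd : 1 ≤ d) (m : ℝ) (hm : 2 ≤ m)
    (u : ℝ → EuclideanSpace ℝ (Fin d) → ℝ)
    (hu_meas : Measurable (Function.uncurry u))
    (hu_nonneg : ∀ t x, 0 ≤ u t x)
    (hprob : ∀ t : ℝ, 0 < t →
      IsProbabilityMeasure (volume.withDensity fun x => ENNReal.ofReal (u t x)))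
    (hu_bdd : ∀ δ : ℝ, 0 < δ → ∃ M : ℝ,
      ∀ᵐ p : ℝ × EuclideanSpace ℝ (Fin d) ∂volume, δ < p.1 → u p.1 p.2 ≤ M)
    (hPME : ∀ s t : ℝ, 0 < s → s < t →
      ∀ ζ : EuclideanSpace ℝ (Fin d) → ℝ, ContDiff ℝ 2 ζ → HasCompactSupport ζ →
        (∫ x, ζ x ∂(volume.withDensity fun x => ENNReal.ofReal (u t x))) -
          (∫ x, ζ x ∂(volume.withDensity fun x => ENNReal.ofReal (u s x))) =
          ∫ r in s..t, ∫ x, u r x ^ m * lapl ζ x) :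
    ∃ N : Set ℝ, N ⊆ Ioi 0 ∧ volume N = 0 ∧
      ∀ t : ℝ, 0 < t → t ∉ N →
        ∀ ζ : EuclideanSpace ℝ (Fin d) → ℝ, ContDiff ℝ 3 ζ → HasCompactSupport ζ →
          DifferentiableAt ℝ
            (fun τ : ℝ => ∫ x, ζ x ∂(volume.withDensity fun x => ENNReal.ofReal (u τ x))) t ∧
          DifferentiableAt ℝ
            (fun σ : ℝ => pmEnergy m
              (Measure.map (fun x => x + σ • gradVec ζ x)
                (volume.withDensity fun x => ENNReal.ofReal (u t x)))) 0 ∧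
          deriv
            (fun τ : ℝ => ∫ x, ζ x ∂(volume.withDensity fun x => ENNReal.ofReal (u τ x))) t =
          - deriv
            (fun σ : ℝ => pmEnergy m
              (Measure.map (fun x => x + σ • gradVec ζ x)
                (volume.withDensity fun x => ENNReal.ofReal (u t x)))) 0 := by
  have hu_r : ∀ r, Measurable (u r) := fun r => hu_meas.comp measurable_prodMk_left
  have hm0 : 0 ≤ m := by linarith
  set δ : ℕ → ℝ := fun k => 1 / ((k : ℝ) + 1) with hδ
  have hδpos : ∀ k, 0 < δ k := fun k => by positivity
  choose M₀ hM₀ using fun k => hu_bdd (δ k) (hδpos k)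
  have hM : ∀ k, ∀ᵐ r : ℝ, ∀ᵐ x, δ k < r → u r x ≤ max (M₀ k) 0 := by
    intro k
    have h := hM₀ k
    rw [Measure.volume_eq_prod] at h
    filter_upwards [Measure.ae_ae_of_ae_prod h] with r hr
    filter_upwards [hr] with x hx hlt
    exact (hx hlt).trans (le_max_left _ _)
  set w : ℕ → ℝ → EuclideanSpace ℝ (Fin d) → ℝ :=
    fun k r x => if δ k < r then u r x ^ m else 0 with hw
  have hgood : ∀ᵐ t : ℝ, ∀ k, (∀ᵐ x, δ k < t → u t x ≤ max (M₀ k) 0) ∧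
      ∀ g : EuclideanSpace ℝ (Fin d) → ℝ, Integrable g →
      ∀ c, HasDerivAt (fun τ => ∫ r in c..τ, ∫ x, w k r x * g x) (∫ x, w k t x * g x) t := by
    rw [ae_all_iff]
    intro k
    have hwm : Measurable (Function.uncurry (w k)) :=
      Measurable.ite (measurableSet_lt measurable_const measurable_fst)
        (hu_meas.pow_const m) measurable_const
    filter_upwards [hM k, aux_time (w k) hwm ((max (M₀ k) 0) ^ m)
      (Real.rpow_nonneg (le_max_right _ _) _) (by
        filter_upwards [hM k] with r hr
        filter_upwards [hr] with x hx
        simp only [hw]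
        split_ifs with h
        · rw [Real.norm_of_nonneg (Real.rpow_nonneg (hu_nonneg r x) m)]
          exact Real.rpow_le_rpow (hu_nonneg r x) (hx h) hm0
        · rw [norm_zero]
          exact Real.rpow_nonneg (le_max_right _ _) _)] with t h1 h2
    exact ⟨h1, h2⟩
  refine ⟨Ioi 0 ∩ {t | ¬ _}, inter_subset_left, measure_mono_null inter_subset_right
    (ae_iff.1 hgood), ?_⟩
  intro t ht htN ζ hζ hc
  have htg : ∀ k, (∀ᵐ x, δ k < t → u t x ≤ max (M₀ k) 0) ∧
      ∀ g : EuclideanSpace ℝ (Fin d) → ℝ, Integrable g →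
      ∀ c, HasDerivAt (fun τ => ∫ r in c..τ, ∫ x, w k r x * g x) (∫ x, w k t x * g x) t := by
    by_contra hcon
    exact htN ⟨ht, hcon⟩
  obtain ⟨k, hk⟩ := exists_nat_one_div_lt ht
  obtain ⟨hb, hder⟩ := htg k
  have hkt : δ k < t := hk
  -- integrability of `u t ^ m`
  have hui : Integrable (u t) := by
    refine ⟨(hu_r t).aestronglyMeasurable, ?_⟩
    rw [hasFiniteIntegral_iff_ofReal (Filter.Eventually.of_forall (hu_nonneg t))]
    have h1 := (hprob t ht).measure_univ
    rw [withDensity_apply _ MeasurableSet.univ, Measure.restrict_univ] at h1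
    rw [h1]; exact ENNReal.one_lt_top
  have hvm : Integrable fun x => u t x ^ m := by
    refine (hui.const_mul ((max (M₀ k) 0) ^ (m - 1))).mono'
      ((hu_r t).pow_const m).aestronglyMeasurable ?_
    filter_upwards [hb] with x hx
    rw [Real.norm_of_nonneg (Real.rpow_nonneg (hu_nonneg t x) m)]
    have h2 : u t x ^ m = u t x ^ (m - 1) * u t x := by
      rw [← Real.rpow_add_one' (hu_nonneg t x) (by linarith), sub_add_cancel]
    rw [h2]
    exact mul_le_mul_of_nonneg_right
      (Real.rpow_le_rpow (hu_nonneg t x) (hx hkt) (by linarith)) (hu_nonneg t x)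
  have hE := aux_energy_deriv m hm (u t) (hu_r t) (hu_nonneg t) hvm ζ hζ hc
  -- integrability of the Laplacian
  have hli : Integrable (lapl ζ) := by
    have hζ' : ContDiff ℝ 2 (fderiv ℝ ζ) := hζ.fderiv_right (by norm_num)
    refine integrable_finset_sum _ fun i _ => ?_
    have h1 : ContDiff ℝ 2 fun y => fderiv ℝ ζ y (EuclideanSpace.single i 1) :=
      hζ'.clm_apply contDiff_const
    have h2 : HasCompactSupport fun y => fderiv ℝ ζ y (EuclideanSpace.single i 1) :=
      hc.fderiv_apply (𝕜 := ℝ) _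
    refine Continuous.integrable_of_hasCompactSupport ?_ (h2.fderiv_apply (𝕜 := ℝ) _)
    exact (h1.continuous_fderiv (by norm_num)).clm_apply continuous_const
  set s := (δ k + t) / 2 with hs
  have hks : δ k < s := by rw [hs]; linarith
  have hst : s < t := by rw [hs]; linarith
  have hwt : (∫ x, w k t x * lapl ζ x) = ∫ x, u t x ^ m * lapl ζ x := by
    simp only [hw, if_pos hkt]
  have hT : HasDerivAt
      (fun τ : ℝ => ∫ x, ζ x ∂(volume.withDensity fun x => ENNReal.ofReal (u τ x)))
      (∫ x, u t x ^ m * lapl ζ x) t := by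
    have h1 := (hder (lapl ζ) hli s).const_add
      (∫ x, ζ x ∂(volume.withDensity fun x => ENNReal.ofReal (u s x)))
    rw [hwt] at h1
    refine h1.congr_of_eventuallyEq ?_
    filter_upwards [lt_mem_nhds hst] with τ hτ
    have h2 := hPME s τ ((hδpos k).trans hks) hτ ζ (hζ.of_le (by norm_num)) hc
    have h3 : (∫ r in s..τ, ∫ x, w k r x * lapl ζ x) = ∫ r in s..τ, ∫ x, u r x ^ m * lapl ζ x := by
      refine intervalIntegral.integral_congr fun r hr => ?_
      rw [uIcc_of_le hτ.le] at hr
      have : δ k < r := hks.trans_le hr.1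
      simp only [hw, if_pos this]
    rw [h3, ← h2]
    ring
  refine ⟨hT.differentiableAt, hE.differentiableAt, ?_⟩
  rw [hT.deriv, hE.deriv, neg_neg]
end

section
/- Let β ∈ C¹(ℝ) with β(0) = 0 and 0 < γ ≤ β'(r) ≤ γ₁ < ∞ for all r ∈ ℝ; let Φ ∈ C¹(ℝ^d) with bounded gradient and set D := −∇Φ. Define g(s) := ∫₁^s β'(w)/w dw for s > 0 and η(r) := ∫₀^r g(s) ds for r ≥ 0. Let u: (0,∞)×ℝ^d → [0,∞) be measurable such that: (a) for every t > 0 the measure μ_t := u(t,·)·Leb is a Borel probability measure; (b) u is essentially bounded on (0,∞)×ℝ^d; (c) for almost every t > 0, both x ↦ u(t,x) log u(t,x) (set to 0 where u(t,x)=0) and x ↦ Φ(x)u(t,x) are Lebesgue-integrable; (d) for all 0 < s < t and all ζ ∈ C²_c(ℝ^d): ∫ζ dμ_t − ∫ζ dμ_s = ∫_s^t ∫_{ℝ^d} ( β(u(r,x))·Δζ(x) + u(r,x)·D(x)·∇ζ(x) ) dx dr (i.e. u is a bounded distributional probability solution of ∂_t u = Δβ(u) − div(D u)). Define E(ρ)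 := ∫_{ℝ^d} η((dρ/dLeb)(x)) dx + ∫_{ℝ^d} Φ dρ for Borel probability measures ρ on ℝ^d for which both integrals are defined and finite, where dρ/dLeb is the Radon–Nikodym derivative of the absolutely continuous part of ρ. Then there exists a Lebesgue-null set N ⊆ (0,∞) such that for every t ∈ (0,∞)∖N and every ζ ∈ C³_c(ℝ^d): the map τ ↦ ∫ζ dμ_τ is differentiable at τ = t, there is ε > 0 such that E( μ_t∘(Id + σ∇ζ)^{-1} ) is defined and finite for all σ ∈ (−ε,ε) and differentiable at σ = 0, and d/dτ (∫ζ dμ_τ)|_{τ=t} = − d/dσ E( μ_t∘(Id + σ∇ζ)^{-1} )|_{σ=0}. -/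
open MeasureTheory Real Set

/-- `η(r) := ∫₀^r g(s) ds` with `g(s) := ∫₁^s β'(w)/w dw`. -/
noncomputable def etaGen (β : ℝ → ℝ) (r : ℝ) : ℝ :=
  ∫ s in (0 : ℝ)..r, ∫ w in (1 : ℝ)..s, deriv β w / w

/-- The energy `E(ρ) := ∫ η((dρ/dLeb)(x)) dx + ∫ Φ dρ`, where `dρ/dLeb` is the
Radon–Nikodym derivative of the absolutely continuous part of `ρ`. -/
noncomputable def energyGen {d : ℕ} (β : ℝ → ℝ) (Φ : EuclideanSpace ℝ (Fin d) → ℝ)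
    (ρ : Measure (EuclideanSpace ℝ (Fin d))) : ℝ :=
  (∫ x, etaGen β ((ρ.rnDeriv volume x).toReal)) + ∫ x, Φ x ∂ρ


lemma lebesgue_common {X : Type*} [PseudoMetricSpace X] [TopologicalSpace.SeparableSpace X]
    [Nonempty X]
    (F : ℝ → X → ℝ) (hm : ∀ x, Measurable (fun r => F r x))
    (hb : ∀ x, ∃ B : ℝ, ∀ r, |F r x| ≤ B) (C : ℝ) (hC : 0 ≤ C)
    (hL : ∀ r x y, |F r x - F r y| ≤ C * dist x y) :
    ∃ N : Set ℝ, volume N = 0 ∧ ∀ t ∉ N, ∀ x,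
      HasDerivAt (fun τ => ∫ r in t..τ, F r x) (F t x) t := by
  have hintg : ∀ x, LocallyIntegrable (fun r => F r x) volume := by
    intro x
    obtain ⟨B, hB⟩ := hb x
    refine (locallyIntegrable_const B).mono (hm x).aestronglyMeasurable (ae_of_all _ fun r => ?_)
    rw [Real.norm_eq_abs, Real.norm_eq_abs]
    exact (hB r).trans (le_abs_self B)
  have hii : ∀ x a b, IntervalIntegrable (fun r => F r x) volume a b := fun x a b =>
    ((hintg x).integrableOn_isCompact isCompact_uIcc).intervalIntegrable
  have hae : ∀ᵐ t, ∀ k : ℕ, ∀ c, HasDerivAt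
      (fun τ => ∫ r in c..τ, F r (TopologicalSpace.denseSeq X k))
      (F t (TopologicalSpace.denseSeq X k)) t :=
    ae_all_iff.2 fun k => LocallyIntegrable.ae_hasDerivAt_integral (hintg _)
  refine ⟨_, hae, ?_⟩
  intro t ht x
  simp only [mem_compl_iff, mem_ofPred_eq, not_not] at ht
  rw [hasDerivAt_iff_isLittleO, Asymptotics.isLittleO_iff]
  intro c hc
  obtain ⟨k, hk⟩ : ∃ k, C * dist x (TopologicalSpace.denseSeq X k) ≤ c / 3 := by
    have hd : 0 < c / (3 * (C + 1)) := by positivity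
    obtain ⟨y, hk, ⟨k, rfl⟩⟩ := Metric.dense_iff.1 (TopologicalSpace.denseRange_denseSeq X) x _ hd
    refine ⟨k, ?_⟩
    rw [Metric.mem_ball, dist_comm] at hk
    calc C * dist x (TopologicalSpace.denseSeq X k) ≤ (C+1) * (c / (3 * (C + 1))) := by
          gcongr
          linarith
      _ = c / 3 := by field_simp
  set y := TopologicalSpace.denseSeq X k
  have h1 := ht k t
  rw [hasDerivAt_iff_isLittleO, Asymptotics.isLittleO_iff] at h1
  filter_upwards [h1 (show 0 < c / 3 by positivity)] with τ hτ
  simp only [intervalIntegral.integral_same, sub_zero, smul_eq_mul, Real.norm_eq_abs] at hτ ⊢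
  have h2 : |∫ r in t..τ, (F r x - F r y)| ≤ c / 3 * |τ - t| := by
    have := intervalIntegral.norm_integral_le_of_norm_le_const (a := t) (b := τ) (C := c/3)
      (f := fun r => F r x - F r y) (fun r _ => (hL r x y).trans hk)
    simpa using this
  rw [intervalIntegral.integral_sub (hii _ _ _) (hii _ _ _)] at h2
  have h3 : |(τ - t) * (F t x - F t y)| ≤ c / 3 * |τ - t| := by
    rw [abs_mul, mul_comm]
    gcongr
    exact (hL t x y).trans hk
  calc _ = |((∫ r in t..τ, F r y) - (τ - t) * F t y) +
      ((∫ r in t..τ, F r x) - (∫ r in t..τ, F r y)) - (τ - t) * (F t x - F t y)| := by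
        congr 1; ring
    _ ≤ _ := (abs_sub _ _).trans (add_le_add_left (abs_add_le _ _) _)
    _ ≤ c / 3 * |τ - t| + c / 3 * |τ - t| + c / 3 * |τ - t| := by gcongr
    _ = _ := by ring

noncomputable def gFun (β : ℝ → ℝ) (s : ℝ) : ℝ := ∫ w in (1 : ℝ)..s, deriv β w / w


lemma gFun_hasDerivAt {β : ℝ → ℝ} (hβ : ContDiff ℝ 1 β) {s : ℝ} (hs : 0 < s) :
    HasDerivAt (gFun β) (deriv β s / s) s := by
  have hc : Continuous (deriv β) := hβ.continuous_deriv le_rfl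
  have hco : ContinuousOn (fun w => deriv β w / w) (Ioi 0) :=
    hc.continuousOn.div continuousOn_id fun x hx => ne_of_gt hx
  apply intervalIntegral.integral_hasDerivAt_right
  · apply ContinuousOn.intervalIntegrable
    exact hco.mono fun x hx => lt_of_lt_of_le (lt_min one_pos hs) hx.1
  · exact hco.stronglyMeasurableAtFilter isOpen_Ioi _ hs
  · exact hco.continuousAt (Ioi_mem_nhds hs)

lemma gFun_bound {β : ℝ → ℝ} {γ γ₁ : ℝ} (hγ : 0 < γ)
    (hβ'_lb : ∀ r, γ ≤ deriv β r) (hβ'_ub : ∀ r, deriv β r ≤ γ₁) {s : ℝ} (hs : 0 < s) :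
    |gFun β s| ≤ γ₁ * |Real.log s| := by
  have h := intervalIntegral.norm_integral_le_abs_of_norm_le (a := 1) (b := s)
    (f := fun w => deriv β w / w) (g := fun w => γ₁ * w⁻¹) (μ := volume) ?_ ?_
  · rw [intervalIntegral.integral_const_mul, integral_inv_of_pos one_pos hs, abs_mul,
      abs_of_nonneg (hγ.le.trans ((hβ'_lb 0).trans (hβ'_ub 0)))] at h
    simpa [gFun] using h
  · refine (ae_restrict_mem measurableSet_uIoc).mono fun w hw => ?_
    have hw : 0 < w := lt_of_le_of_lt (le_min zero_le_one hs.le) hw.1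
    rw [norm_div, Real.norm_eq_abs, Real.norm_eq_abs, abs_of_pos hw,
      abs_of_pos (hγ.trans_le (hβ'_lb w)), div_eq_mul_inv]
    gcongr
    exact hβ'_ub w
  · apply ContinuousOn.intervalIntegrable
    apply continuousOn_const.mul
    exact continuousOn_id.inv₀ fun x hx => ne_of_gt (lt_of_lt_of_le (lt_min one_pos hs) hx.1)

lemma beta_bound {β : ℝ → ℝ} (hβ : ContDiff ℝ 1 β) (hβ0 : β 0 = 0) {γ γ₁ : ℝ} (hγ : 0 < γ)
    (hβ'_lb : ∀ r, γ ≤ deriv β r) (hβ'_ub : ∀ r, deriv β r ≤ γ₁) (s : ℝ) :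
    |β s| ≤ γ₁ * |s| := by
  have := Convex.norm_image_sub_le_of_norm_deriv_le (f := β) (C := γ₁) (s := univ) (x := 0) (y := s)
    (fun x _ => (hβ.differentiable one_ne_zero) x) (fun x _ => by
      rw [Real.norm_eq_abs, abs_of_pos (hγ.trans_le (hβ'_lb x))]; exact hβ'_ub x) convex_univ
      trivial trivial
  simpa [hβ0] using this

lemma etaGen_eq {β : ℝ → ℝ} (hβ : ContDiff ℝ 1 β) (hβ0 : β 0 = 0) {γ γ₁ : ℝ} (hγ : 0 < γ)
    (hβ'_lb : ∀ r, γ ≤ deriv β r) (hβ'_ub : ∀ r, deriv β r ≤ γ₁) {r : ℝ} (hr : 0 ≤ r) :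
    etaGen β r = r * gFun β r - β r := by
  have hγ₁ : 0 ≤ γ₁ := hγ.le.trans ((hβ'_lb 0).trans (hβ'_ub 0))
  have h := intervalIntegral.integral_eq_sub_of_hasDerivAt_of_le (a := 0) (b := r)
    (f := fun r => r * gFun β r - β r) (f' := gFun β) hr ?_ ?_ ?_
  · change ∫ s in (0:ℝ)..r, gFun β s = _
    rw [h]; simp [hβ0]
  · apply ContinuousOn.sub _ hβ.continuous.continuousOn
    intro x hx
    rcases hx.1.eq_or_lt with h0 | h0
    · subst h0
      have h1 : Filter.Tendsto (fun s => γ₁ * |s * Real.log s|) (nhdsWithin 0 (Icc 0 r)) (nhds 0) := by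
        have : Continuous (fun s : ℝ => γ₁ * |s * Real.log s|) :=
          continuous_const.mul Real.continuous_mul_log.abs
        simpa using (this.tendsto 0).mono_left nhdsWithin_le_nhds
      rw [ContinuousWithinAt, zero_mul]
      refine squeeze_zero_norm' ?_ h1
      filter_upwards [self_mem_nhdsWithin] with s hs
      rcases hs.1.eq_or_lt with h0 | h0
      · subst h0; simp
      · rw [norm_mul, abs_mul, Real.norm_eq_abs, Real.norm_eq_abs]
        calc _ ≤ |s| * (γ₁ * |Real.log s|) := by
              gcongr
              exact gFun_bound hγ hβ'_lb hβ'_ub h0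
          _ = _ := by ring
    · exact (continuousAt_id.mul (gFun_hasDerivAt hβ h0).continuousAt).continuousWithinAt
  · intro x hx
    have h0 : 0 < x := hx.1
    have := ((hasDerivAt_id x).mul (gFun_hasDerivAt hβ h0)).sub
      (hβ.differentiable one_ne_zero x).hasDerivAt
    refine this.congr_deriv ?_
    simp
    field_simp
    ring
  · have hl : IntervalIntegrable (fun s => γ₁ * Real.log s) volume 0 r :=
      intervalIntegral.intervalIntegrable_log'.const_mul _
    refine hl.mono_fun ?_ ?_
    · have : ContinuousOn (gFun β) (uIoc 0 r) := by
        intro x hx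
        rw [uIoc_of_le hr] at hx
        exact (gFun_hasDerivAt hβ hx.1).continuousAt.continuousWithinAt
      exact this.aestronglyMeasurable measurableSet_uIoc
    · refine (ae_restrict_mem measurableSet_uIoc).mono fun w hw => ?_
      rw [uIoc_of_le hr] at hw
      show ‖gFun β w‖ ≤ ‖γ₁ * Real.log w‖
      rw [norm_mul, Real.norm_eq_abs, Real.norm_eq_abs, Real.norm_eq_abs, abs_of_nonneg hγ₁]
      exact gFun_bound hγ hβ'_lb hβ'_ub hw.1

lemma etaGen_bound {β : ℝ → ℝ} (hβ : ContDiff ℝ 1 β) (hβ0 : β 0 = 0) {γ γ₁ : ℝ} (hγ : 0 < γ)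
    (hβ'_lb : ∀ r, γ ≤ deriv β r) (hβ'_ub : ∀ r, deriv β r ≤ γ₁) {r : ℝ} (hr : 0 ≤ r) :
    |etaGen β r| ≤ γ₁ * |r * Real.log r| + γ₁ * r := by
  rw [etaGen_eq hβ hβ0 hγ hβ'_lb hβ'_ub hr]
  refine (abs_sub _ _).trans (add_le_add ?_ ?_)
  · rcases hr.eq_or_lt with h0 | h0
    · subst h0; simp
    · rw [abs_mul, abs_mul]
      calc _ ≤ |r| * (γ₁ * |Real.log r|) := by
              gcongr
              exact gFun_bound hγ hβ'_lb hβ'_ub h0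
          _ = _ := by ring
  · simpa [abs_of_nonneg hr] using beta_bound hβ hβ0 hγ hβ'_lb hβ'_ub r

lemma etaGen_persp {β : ℝ → ℝ} (hβ : ContDiff ℝ 1 β) (hβ0 : β 0 = 0) {γ γ₁ : ℝ} (hγ : 0 < γ)
    (hβ'_lb : ∀ r, γ ≤ deriv β r) (hβ'_ub : ∀ r, deriv β r ≤ γ₁) {v J : ℝ} (hv : 0 ≤ v)
    (hJ : 0 < J) :
    HasDerivAt (fun J => J * etaGen β (v / J)) (- β (v / J)) J := by
  rcases hv.eq_or_lt with h0 | h0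
  · subst h0
    have : etaGen β 0 = 0 := by simp [etaGen]
    simpa [this, hβ0] using hasDerivAt_const J (0:ℝ)
  · have hd : HasDerivAt (fun J : ℝ => v / J) (-v / J ^ 2) J := by
      have := (hasDerivAt_inv hJ.ne').const_mul v
      exact this.congr_deriv (by ring)
    have hg := (gFun_hasDerivAt hβ (div_pos h0 hJ)).comp J hd
    have hb := (hβ.differentiable one_ne_zero (v / J)).hasDerivAt.comp J hd
    have := (hg.const_mul v).sub ((hasDerivAt_id J).mul hb)
    have h2 : HasDerivAt (fun J => v * gFun β (v / J) - J * β (v / J)) (- β (v / J)) J := by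
      refine this.congr_deriv ?_
      simp
      field_simp
      ring
    refine h2.congr_of_eventuallyEq ?_
    filter_upwards [Ioi_mem_nhds hJ] with K hK
    have hK : 0 < K := hK
    rw [etaGen_eq hβ hβ0 hγ hβ'_lb hβ'_ub (div_pos h0 hK).le]
    field_simp

lemma etaGen_cont {β : ℝ → ℝ} (hβ : ContDiff ℝ 1 β) (hβ0 : β 0 = 0) {γ γ₁ : ℝ} (hγ : 0 < γ)
    (hβ'_lb : ∀ r, γ ≤ deriv β r) (hβ'_ub : ∀ r, deriv β r ≤ γ₁) :
    Measurable (fun r => etaGen β (max r 0)) := by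
  have hm : Measurable (fun r => if 0 < r then r * gFun β r - β r else 0) := by
    have h : ContinuousOn (fun r => r * gFun β r - β r) (Ioi 0) := fun x hx =>
      ((continuousAt_id.mul (gFun_hasDerivAt hβ hx).continuousAt).sub
        hβ.continuous.continuousAt).continuousWithinAt
    have := ContinuousOn.measurable_piecewise (f := (fun r => r * gFun β r - β r))
      (g := fun _ => (0:ℝ)) h continuousOn_const measurableSet_Ioi
    convert this using 1
    ext r
    simp [Set.piecewise]
  convert hm using 2 with r
  split_ifs with h
  · rw [max_eq_left h.le, etaGen_eq hβ hβ0 hγ hβ'_lb hβ'_ub h.le]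
  · rw [max_eq_right (not_lt.1 h)]; simp [etaGen]

lemma gradVec_apply {d : ℕ} (ζ : EuclideanSpace ℝ (Fin d) → ℝ)
    (x : EuclideanSpace ℝ (Fin d)) (i : Fin d) :
    gradVec ζ x i = fderiv ℝ ζ x (EuclideanSpace.single i 1) := rfl

lemma gradVec_contDiff {d : ℕ} {n : ℕ} {ζ : EuclideanSpace ℝ (Fin d) → ℝ}
    (h : ContDiff ℝ (n + 1) ζ) : ContDiff ℝ n (gradVec ζ) := by
  rw [contDiff_euclidean]
  intro i
  simp only [gradVec_apply]
  exact (h.fderiv_right le_rfl).clm_apply contDiff_const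

lemma gradVec_hcs {d : ℕ} {ζ : EuclideanSpace ℝ (Fin d) → ℝ}
    (h : HasCompactSupport ζ) : HasCompactSupport (gradVec ζ) := by
  have := h.fderiv (𝕜 := ℝ)
  refine this.mono ?_
  intro x hx
  contrapose! hx
  simp only [Function.mem_support, not_not] at hx ⊢
  ext i
  simp [gradVec_apply, hx]

noncomputable def hessMat {d : ℕ} (ζ : EuclideanSpace ℝ (Fin d) → ℝ)
    (x : EuclideanSpace ℝ (Fin d)) : Fin d → Fin d → ℝ :=
  fun i j => fderiv ℝ (gradVec ζ) x (EuclideanSpace.single j 1) i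

noncomputable def detFun {d : ℕ} (σ : ℝ) (m : Fin d → Fin d → ℝ) : ℝ :=
  (1 + σ • Matrix.of m).det

lemma hess_trace {d : ℕ} {ζ : EuclideanSpace ℝ (Fin d) → ℝ}
    (h : ContDiff ℝ 2 ζ) (x) : (Matrix.of (hessMat ζ x)).trace = lapl ζ x := by
  unfold Matrix.trace lapl
  refine Finset.sum_congr rfl fun i _ => ?_
  have h1 : ContDiff ℝ 1 (gradVec ζ) := gradVec_contDiff (n := 1) (by simpa [one_add_one_eq_two] using h)
  have h2 := (h1.differentiable one_ne_zero x).hasFDerivAt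
  have h3 : HasFDerivAt (fun y => fderiv ℝ ζ y (EuclideanSpace.single i 1))
      ((EuclideanSpace.proj (𝕜 := ℝ) i).comp (fderiv ℝ (gradVec ζ) x)) x :=
    (EuclideanSpace.proj (𝕜 := ℝ) i).hasFDerivAt.comp x h2
  rw [h3.fderiv]
  rfl

lemma hess_det {d : ℕ} (ζ : EuclideanSpace ℝ (Fin d) → ℝ) (σ : ℝ) (x) :
    (ContinuousLinearMap.id ℝ (EuclideanSpace ℝ (Fin d)) + σ • fderiv ℝ (gradVec ζ) x).det
      = detFun σ (hessMat ζ x) := by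
  rw [ContinuousLinearMap.det, ← LinearMap.det_toMatrix (EuclideanSpace.basisFun (Fin d) ℝ).toBasis]
  unfold detFun
  congr 1
  ext i j
  simp [LinearMap.toMatrix_apply, hessMat, Matrix.one_apply]

lemma detFun_contDiff {d : ℕ} :
    ContDiff ℝ 1 (fun p : ℝ × (Fin d → Fin d → ℝ) => detFun p.1 p.2) := by
  unfold detFun
  simp only [Matrix.det_apply, Matrix.add_apply, Matrix.smul_apply, Matrix.of_apply]
  fun_prop

lemma detFun_deriv {d : ℕ} : ∃ D : ℝ → (Fin d → Fin d → ℝ) → ℝ,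
    Continuous (fun p : ℝ × (Fin d → Fin d → ℝ) => D p.1 p.2) ∧
    (∀ σ m, HasDerivAt (fun σ => detFun σ m) (D σ m) σ) ∧
    ∀ m, D 0 m = (Matrix.of m).trace := by
  let f := (fun p : ℝ × (Fin d → Fin d → ℝ) => detFun p.1 p.2)
  have hf : ContDiff ℝ 1 f := detFun_contDiff
  have hD : ∀ σ m, HasDerivAt (fun σ => detFun σ m) (fderiv ℝ f (σ, m) (1, 0)) σ := by
    intro σ m
    have h1 := (hf.differentiable one_ne_zero (σ, m)).hasFDerivAt
    have h2 : HasDerivAt (fun σ : ℝ => (σ, m)) (1, 0) σ :=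
      (hasDerivAt_id σ).prodMk (hasDerivAt_const σ m)
    exact h1.comp_hasDerivAt σ h2
  refine ⟨fun σ m => fderiv ℝ f (σ, m) (1, 0), ?_, hD, ?_⟩
  · exact (hf.continuous_fderiv one_ne_zero).clm_apply continuous_const
  · intro m
    refine (hD 0 m).unique ?_
    have : (fun σ => detFun σ m) = fun r => 1 + (Matrix.of m).trace * r + (Matrix.det (1 + (Polynomial.X : Polynomial ℝ) • (Matrix.of m).map Polynomial.C)).divX.divX.eval r * r ^ 2 := by
      ext r
      exact Matrix.det_one_add_smul r _
    rw [this]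
    have h1 := ((hasDerivAt_id (0:ℝ)).const_mul (Matrix.of m).trace).const_add 1
    have h2 := ((Matrix.det (1 + (Polynomial.X : Polynomial ℝ) • (Matrix.of m).map Polynomial.C)).divX.divX.hasDerivAt 0).mul (hasDerivAt_pow 2 (0:ℝ))
    refine (h1.add h2).congr_deriv ?_
    simp

lemma hess_cont {d : ℕ} {ζ : EuclideanSpace ℝ (Fin d) → ℝ} (h : ContDiff ℝ 2 ζ) :
    Continuous (hessMat ζ) := by
  have h1 : ContDiff ℝ 1 (gradVec ζ) := gradVec_contDiff (n := 1) (by simpa [one_add_one_eq_two] using h)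
  refine continuous_pi fun i => continuous_pi fun j => ?_
  have := (h1.continuous_fderiv one_ne_zero).clm_apply
    (continuous_const (y := EuclideanSpace.single j (1:ℝ)))
  exact (EuclideanSpace.proj (𝕜 := ℝ) i).continuous.comp this

lemma hess_hcs {d : ℕ} {ζ : EuclideanSpace ℝ (Fin d) → ℝ} (h : HasCompactSupport ζ) :
    HasCompactSupport (hessMat ζ) := by
  refine ((gradVec_hcs h).fderiv (𝕜 := ℝ)).mono ?_
  intro x hx
  contrapose! hx
  simp only [Function.mem_support, not_not] at hx ⊢
  ext i j
  simp [hessMat, hx]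

lemma jac_family {d : ℕ} {ζ : EuclideanSpace ℝ (Fin d) → ℝ} (h : ContDiff ℝ 2 ζ)
    (hc : HasCompactSupport ζ) : ∃ C : ℝ, 0 < C ∧ ∀ x,
      (∀ σ ∈ Icc (-1:ℝ) 1, ∃ D, |D| ≤ C ∧ HasDerivAt (fun σ => detFun σ (hessMat ζ x)) D σ) ∧
      HasDerivAt (fun σ => detFun σ (hessMat ζ x)) (lapl ζ x) 0 := by
  obtain ⟨D, hDc, hD, hD0⟩ := detFun_deriv (d := d)
  have hK : IsCompact (Icc (-1:ℝ) 1 ×ˢ range (hessMat ζ)) :=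
    isCompact_Icc.prod ((hess_hcs hc).isCompact_range (hess_cont h))
  obtain ⟨C, hC⟩ := hK.exists_bound_of_continuousOn hDc.continuousOn
  refine ⟨|C| + 1, by positivity, fun x => ⟨fun σ hσ => ⟨D σ (hessMat ζ x), ?_, hD _ _⟩, ?_⟩⟩
  · have := hC (σ, hessMat ζ x) ⟨hσ, mem_range_self x⟩
    exact this.trans (by linarith [le_abs_self C])
  · rw [← hess_trace h, ← hD0]; exact hD _ _

lemma homeo_family {E : Type*} [NormedAddCommGroup E] [NormedSpace ℝ E] [CompleteSpace E]
    {φ : E → E} {L : NNReal} (hφ : LipschitzWith L φ) {σ : ℝ} (hσ : |σ| * L < 1) :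
    ∃ T : E ≃ₜ E, ∀ x, T x = x + σ • φ x := by
  have h : ApproximatesLinearOn (fun x => x + σ • φ x)
      ((ContinuousLinearEquiv.refl ℝ E : E ≃L[ℝ] E) : E →L[ℝ] E) univ (‖σ‖₊ * L) := by
    intro x _ y _
    have h1 := hφ.norm_sub_le x y
    have h2 : x + σ • φ x - (y + σ • φ y) -
        ((ContinuousLinearEquiv.refl ℝ E : E ≃L[ℝ] E) : E →L[ℝ] E) (x - y)
        = σ • (φ x - φ y) := by
      simp [smul_sub]; abel
    rw [h2, norm_smul, NNReal.coe_mul, coe_nnnorm, mul_assoc]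
    gcongr
  refine ⟨h.toHomeomorph _ ?_, fun x => rfl⟩
  rcases subsingleton_or_nontrivial E with hE | hE
  · exact Or.inl hE
  · right
    have : ‖((ContinuousLinearEquiv.refl ℝ E).symm : E →L[ℝ] E)‖₊ = 1 := by
      ext; simp
    rw [this, inv_one, ← NNReal.coe_lt_coe]
    simpa using hσ

lemma pushforward_formula {E : Type*} [NormedAddCommGroup E] [InnerProductSpace ℝ E]
    [FiniteDimensional ℝ E]
    [MeasurableSpace E] [BorelSpace E] (T : E ≃ₜ E) (T' : E → E →L[ℝ] E)
    (hT : ∀ x, HasFDerivAt T (T' x) x) (hJ : ∀ x, 0 < (T' x).det)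
    (hJm : Measurable fun x => (T' x).det)
    (v : E → ℝ) (hv : Measurable v) (hv0 : ∀ x, 0 ≤ v x) (h : ℝ → ℝ) :
    (Integrable (fun y => h ((Measure.map T (volume.withDensity fun x =>
      ENNReal.ofReal (v x))).rnDeriv volume y).toReal) volume ↔
      Integrable (fun x => (T' x).det * h (v x / (T' x).det)) volume) ∧
    ∫ y, h ((Measure.map T (volume.withDensity fun x =>
      ENNReal.ofReal (v x))).rnDeriv volume y).toReal =
      ∫ x, (T' x).det * h (v x / (T' x).det) := by
  set w : E → ℝ := fun y => v (T.symm y) / (T' (T.symm y)).det with hw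
  have hwm : Measurable w := (hv.comp T.symm.continuous.measurable).div
    (hJm.comp T.symm.continuous.measurable)
  have hw0 : ∀ y, 0 ≤ w y := fun y => div_nonneg (hv0 _) (hJ _).le
  have hmap : Measure.map T (volume.withDensity fun x => ENNReal.ofReal (v x)) =
      volume.withDensity fun y => ENNReal.ofReal (w y) := by
    ext s hs
    have hs' : MeasurableSet (T ⁻¹' s) := T.continuous.measurable hs
    rw [Measure.map_apply T.continuous.measurable hs, withDensity_apply _ hs',
      withDensity_apply _ hs]
    have := lintegral_image_eq_lintegral_abs_det_fderiv_mul volume hs'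
      (fun x _ => (hT x).hasFDerivWithinAt) T.injective.injOn (fun y => ENNReal.ofReal (w y))
    rw [image_preimage_eq _ T.surjective] at this
    rw [this]
    refine lintegral_congr fun x => ?_
    rw [← ENNReal.ofReal_mul (abs_nonneg _), abs_of_pos (hJ x)]
    simp only [hw, T.symm_apply_apply]
    rw [mul_div_cancel₀ _ (hJ x).ne']
  have hae : (fun y => h ((Measure.map T (volume.withDensity fun x =>
      ENNReal.ofReal (v x))).rnDeriv volume y).toReal) =ᵐ[volume] fun y => h (w y) := by
    rw [hmap]
    filter_upwards [Measure.rnDeriv_withDensity volume hwm.ennreal_ofReal] with y hy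
    rw [hy, ENNReal.toReal_ofReal (hw0 y)]
  rw [integrable_congr hae, integral_congr_ae hae]
  have h1 := integrableOn_image_iff_integrableOn_abs_det_fderiv_smul volume MeasurableSet.univ
      (fun x _ => (hT x).hasFDerivWithinAt) T.injective.injOn (fun y => h (w y))
  have h2 := integral_image_eq_integral_abs_det_fderiv_smul volume MeasurableSet.univ
      (fun x _ => (hT x).hasFDerivWithinAt) T.injective.injOn (fun y => h (w y))
  have h3 : ∀ x, |(T' x).det| • h (w (T x)) = (T' x).det * h (v x / (T' x).det) := by
    intro x
    rw [abs_of_pos (hJ x)]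
    simp [hw]
  rw [image_univ_of_surjective T.surjective] at h1 h2
  simp only [h3, integrableOn_univ, Measure.restrict_univ] at h1 h2
  exact ⟨h1, h2⟩


lemma fderiv_gradVec {d : ℕ} (ζ Φ : EuclideanSpace ℝ (Fin d) → ℝ) (x) :
    fderiv ℝ Φ x (gradVec ζ x) = ∑ i, fderiv ℝ ζ x (EuclideanSpace.single i 1) *
      fderiv ℝ Φ x (EuclideanSpace.single i 1) := by
  have h : gradVec ζ x = ∑ i, gradVec ζ x i • EuclideanSpace.single i (1:ℝ) := by
    have := (EuclideanSpace.basisFun (Fin d) ℝ).sum_repr (gradVec ζ x)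
    simpa using this.symm
  rw [h, map_sum]
  refine Finset.sum_congr rfl fun i _ => ?_
  rw [map_smul, smul_eq_mul, gradVec_apply]

lemma fderiv_gradVec_comm {d : ℕ} (ζ Φ : EuclideanSpace ℝ (Fin d) → ℝ) (x) :
    fderiv ℝ Φ x (gradVec ζ x) = fderiv ℝ ζ x (gradVec Φ x) := by
  rw [fderiv_gradVec, fderiv_gradVec]
  exact Finset.sum_congr rfl fun i _ => mul_comm _ _

lemma potential_part {E : Type*} [NormedAddCommGroup E] [NormedSpace ℝ E]
    [FiniteDimensional ℝ E] [MeasurableSpace E] [BorelSpace E]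
    (Φ : E → ℝ) (hΦ : ContDiff ℝ 1 Φ) {M : ℝ} (hM : ∀ x, ‖fderiv ℝ Φ x‖ ≤ M)
    (φ : E → E) (hφ : Continuous φ) {B : ℝ} (hB : ∀ x, ‖φ x‖ ≤ B)
    (μ : Measure E) [IsProbabilityMeasure μ] (hintg : Integrable Φ μ) :
    (∀ σ : ℝ, Integrable Φ (Measure.map (fun x => x + σ • φ x) μ)) ∧
    HasDerivAt (fun σ : ℝ => ∫ x, Φ x ∂(Measure.map (fun x => x + σ • φ x) μ))
      (∫ x, fderiv ℝ Φ x (φ x) ∂μ) 0 := by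
  have hc : ∀ σ : ℝ, Continuous (fun x => x + σ • φ x) := fun σ => by fun_prop
  have hM0 : 0 ≤ M := (norm_nonneg _).trans (hM 0)
  have hB0 : 0 ≤ B := (norm_nonneg _).trans (hB 0)
  have hLip : ∀ x y, ‖Φ y - Φ x‖ ≤ M * ‖y - x‖ := fun x y =>
    Convex.norm_image_sub_le_of_norm_fderiv_le (𝕜 := ℝ)
      (fun z _ => hΦ.differentiable one_ne_zero z) (fun z _ => hM z) convex_univ trivial trivial
  have hLip2 : ∀ x, ∀ σ τ : ℝ, ‖Φ (x + σ • φ x) - Φ (x + τ • φ x)‖ ≤ M * B * ‖σ - τ‖ := by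
    intro x σ τ
    refine (hLip _ _).trans ?_
    rw [add_sub_add_left_eq_sub, ← sub_smul, norm_smul]
    calc _ ≤ M * (‖σ - τ‖ * B) := by gcongr; exact hB x
      _ = _ := by ring
  have hmeas : ∀ σ : ℝ, AEStronglyMeasurable (fun x => Φ (x + σ • φ x)) μ := fun σ =>
    (hΦ.continuous.comp (hc σ)).aestronglyMeasurable
  have hI : ∀ σ : ℝ, Integrable (fun x => Φ (x + σ • φ x)) μ := by
    intro σ
    have h1 : Integrable (fun x => Φ (x + σ • φ x) - Φ x) μ := by
      refine (integrable_const (M * B * ‖σ - 0‖)).mono'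
        ((hmeas σ).sub hΦ.continuous.aestronglyMeasurable) (ae_of_all _ fun x => ?_)
      simpa using hLip2 x σ 0
    refine (h1.add hintg).congr (ae_of_all _ fun x => ?_)
    simp
  refine ⟨fun σ => ?_, ?_⟩
  · rw [integrable_map_measure hΦ.continuous.aestronglyMeasurable (hc σ).aemeasurable]
    exact hI σ
  · have heq : (fun σ : ℝ => ∫ x, Φ x ∂(Measure.map (fun x => x + σ • φ x) μ)) =
        fun σ => ∫ x, Φ (x + σ • φ x) ∂μ := by
      ext σ
      exact integral_map (hc σ).aemeasurable hΦ.continuous.aestronglyMeasurable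
    rw [heq]
    refine (hasDerivAt_integral_of_dominated_loc_of_lip (𝕜 := ℝ) (s := univ)
      (bound := fun _ => M * B) Filter.univ_mem
      (Filter.Eventually.of_forall hmeas) (hI 0) ?_ ?_ (integrable_const _) ?_).2
    · exact ((hΦ.continuous_fderiv one_ne_zero).clm_apply hφ).aestronglyMeasurable
    · refine ae_of_all _ fun x => LipschitzOnWith.of_dist_le_mul fun σ _ τ _ => ?_
      rw [dist_eq_norm, dist_eq_norm, Real.coe_nnabs, abs_of_nonneg (by positivity)]
      exact hLip2 x σ τ
    · refine ae_of_all _ fun x => ?_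
      have h1 : HasDerivAt (fun σ : ℝ => x + σ • φ x) (φ x) 0 := by
        simpa using ((hasDerivAt_id (0:ℝ)).smul_const (φ x)).const_add x
      have h2 : HasFDerivAt Φ (fderiv ℝ Φ x) (x + (0:ℝ) • φ x) := by
        simpa using (hΦ.differentiable one_ne_zero x).hasFDerivAt
      exact h2.comp_hasDerivAt 0 h1

lemma entropy_part {d : ℕ} {β : ℝ → ℝ} (hβ : ContDiff ℝ 1 β) (hβ0 : β 0 = 0) {γ γ₁ : ℝ}
    (hγ : 0 < γ) (hβ'_lb : ∀ r, γ ≤ deriv β r) (hβ'_ub : ∀ r, deriv β r ≤ γ₁)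
    (ζ : EuclideanSpace ℝ (Fin d) → ℝ) (hζ : ContDiff ℝ 2 ζ) (hζc : HasCompactSupport ζ)
    (v : EuclideanSpace ℝ (Fin d) → ℝ) (hv : Measurable v) (hv0 : ∀ x, 0 ≤ v x)
    (hvi : Integrable v) (hvl : Integrable (fun x => v x * Real.log (v x))) :
    ∃ ε > (0:ℝ),
      (∀ σ ∈ Ioo (-ε) ε, (∀ x, 0 < detFun σ (hessMat ζ x)) ∧
        Integrable (fun x => detFun σ (hessMat ζ x) * etaGen β (v x / detFun σ (hessMat ζ x)))) ∧
      HasDerivAt (fun σ =>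
        ∫ x, detFun σ (hessMat ζ x) * etaGen β (v x / detFun σ (hessMat ζ x)))
        (∫ x, - β (v x) * lapl ζ x) 0 := by
  obtain ⟨C, hC, hJ⟩ := jac_family hζ hζc
  have hγ₁ : 0 ≤ γ₁ := hγ.le.trans ((hβ'_lb 0).trans (hβ'_ub 0))
  set J : ℝ → EuclideanSpace ℝ (Fin d) → ℝ := fun σ x => detFun σ (hessMat ζ x) with hJdef
  have hJ0 : ∀ x, J 0 x = 1 := fun x => by simp [hJdef, detFun]
  have hJL : ∀ x, ∀ σ ∈ Icc (-1:ℝ) 1, ∀ τ ∈ Icc (-1:ℝ) 1, |J σ x - J τ x| ≤ C * |σ - τ| := by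
    intro x σ hσ τ hτ
    choose! D hD using (hJ x).1
    exact Convex.norm_image_sub_le_of_norm_hasDerivWithin_le (f' := D)
      (fun z hz => (hD z hz).2.hasDerivWithinAt) (fun z hz => (hD z hz).1) (convex_Icc _ _) hτ hσ
  have hJm : ∀ σ, Measurable (J σ) := fun σ => by
    have h1 : Continuous (fun m : Fin d → Fin d → ℝ => detFun σ m) :=
      (detFun_contDiff (d := d)).continuous.comp (by fun_prop : Continuous fun m => (σ, m))
    exact (h1.comp (hess_cont hζ)).measurable
  set ε : ℝ := min 1 (1 / (2 * C)) with hε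
  have hεpos : 0 < ε := by positivity
  have hsub : ∀ σ ∈ Ioo (-ε) ε, σ ∈ Icc (-1:ℝ) 1 := fun σ hσ => by
    have : ε ≤ 1 := min_le_left _ _
    exact ⟨by linarith [hσ.1], by linarith [hσ.2]⟩
  have hJh : ∀ σ ∈ Ioo (-ε) ε, ∀ x, 1 / 2 ≤ J σ x := by
    intro σ hσ x
    have h1 := hJL x σ (hsub σ hσ) 0 (by simp)
    rw [hJ0, sub_zero] at h1
    have h2 : C * |σ| ≤ 1 / 2 := by
      have : |σ| ≤ 1 / (2 * C) := (abs_lt.2 hσ).le.trans (min_le_right _ _)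
      calc C * |σ| ≤ C * (1 / (2 * C)) := by gcongr
        _ = 1 / 2 := by field_simp
    linarith [(abs_le.1 h1).1]
  have h0mem : (0:ℝ) ∈ Ioo (-ε) ε := ⟨by linarith, hεpos⟩
  set h : ℝ → EuclideanSpace ℝ (Fin d) → ℝ := fun σ x => J σ x * etaGen β (v x / J σ x) with hh
  have hL : ∀ x, ∀ σ ∈ Ioo (-ε) ε, ∀ τ ∈ Ioo (-ε) ε,
      |h σ x - h τ x| ≤ (2 * γ₁ * C * v x) * |σ - τ| := by
    intro x σ hσ τ hτ
    have h1 := Convex.norm_image_sub_le_of_norm_hasDerivWithin_le (s := Ici (1/2 : ℝ))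
      (f := fun J => J * etaGen β (v x / J)) (f' := fun J => - β (v x / J))
      (C := 2 * γ₁ * v x)
      (fun z hz => (etaGen_persp hβ hβ0 hγ hβ'_lb hβ'_ub (hv0 x)
        (lt_of_lt_of_le (by norm_num) hz)).hasDerivWithinAt)
      (fun z hz => by
        have hz' : 1 / 2 ≤ z := hz
        have hz0 : 0 < z := lt_of_lt_of_le (by norm_num) hz'
        rw [norm_neg]
        refine (beta_bound hβ hβ0 hγ hβ'_lb hβ'_ub _).trans ?_
        rw [abs_of_nonneg (div_nonneg (hv0 x) hz0.le)]
        have : v x / z ≤ 2 * v x := by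
          rw [div_le_iff₀ hz0]; nlinarith [hv0 x]
        calc _ ≤ γ₁ * (2 * v x) := by gcongr
          _ = _ := by ring) (convex_Ici _) (hJh τ hτ x) (hJh σ hσ x)
    calc _ ≤ (2 * γ₁ * v x) * |J σ x - J τ x| := h1
      _ ≤ (2 * γ₁ * v x) * (C * |σ - τ|) := by
        have := hv0 x
        gcongr
        exact hJL x σ (hsub σ hσ) τ (hsub τ hτ)
      _ = _ := by ring
  have hm : ∀ σ ∈ Ioo (-ε) ε, Measurable (h σ) := by
    intro σ hσ
    have h1 := (etaGen_cont hβ hβ0 hγ hβ'_lb hβ'_ub).comp (hv.div (hJm σ))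
    have h2 : h σ = J σ * ((fun r => etaGen β (max r 0)) ∘ (v / J σ)) := by
      ext x
      have h3 : 0 ≤ v x / J σ x :=
        div_nonneg (hv0 x) (le_trans (by norm_num) (hJh σ hσ x))
      simp [hh, max_eq_left h3]
    rw [h2]
    exact (hJm σ).mul h1
  have hi0 : Integrable (h 0) := by
    have h1 := (hvl.abs.const_mul γ₁).add (hvi.const_mul γ₁)
    refine h1.mono' (hm 0 h0mem).aestronglyMeasurable (ae_of_all _ fun x => ?_)
    simp only [hh, hJ0, div_one, one_mul]
    exact etaGen_bound hβ hβ0 hγ hβ'_lb hβ'_ub (hv0 x)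
  have hi : ∀ σ ∈ Ioo (-ε) ε, Integrable (h σ) := by
    intro σ hσ
    have h1 : Integrable (fun x => h σ x - h 0 x) := by
      refine ((hvi.const_mul (2 * γ₁ * C)).mul_const |σ - 0|).mono'
        ((hm σ hσ).sub (hm 0 h0mem)).aestronglyMeasurable (ae_of_all _ fun x => ?_)
      exact hL x σ hσ 0 h0mem
    refine (h1.add hi0).congr (ae_of_all _ fun x => ?_)
    simp
  refine ⟨ε, hεpos, fun σ hσ => ⟨fun x => lt_of_lt_of_le (by norm_num) (hJh σ hσ x), hi σ hσ⟩, ?_⟩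
  have hlap : Measurable (lapl ζ) := by
    have : lapl ζ = fun x => ∑ i, hessMat ζ x i i := by
      ext x; rw [← hess_trace hζ]; rfl
    rw [this]
    have := hess_cont hζ
    exact Continuous.measurable (by fun_prop)
  refine (hasDerivAt_integral_of_dominated_loc_of_lip (𝕜 := ℝ) (s := Ioo (-ε) ε) (F := h)
      (bound := fun x => 2 * γ₁ * C * v x) (Ioo_mem_nhds h0mem.1 h0mem.2)
      ?_ hi0 ?_ ?_ (hvi.const_mul _) ?_).2
  · filter_upwards [Ioo_mem_nhds h0mem.1 h0mem.2] with σ hσ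
    exact (hm σ hσ).aestronglyMeasurable
  · exact ((hβ.continuous.measurable.comp hv).neg.mul hlap).aestronglyMeasurable
  · refine ae_of_all _ fun x => LipschitzOnWith.of_dist_le_mul fun σ hσ τ hτ => ?_
    have := hv0 x
    have h5 : 0 ≤ 2 * γ₁ * C * v x := by positivity
    rw [Real.dist_eq, Real.dist_eq, Real.coe_nnabs, abs_of_nonneg h5]
    exact hL x σ hσ τ hτ
  · refine ae_of_all _ fun x => ?_
    have h1 := etaGen_persp hβ hβ0 hγ hβ'_lb hβ'_ub (hv0 x) (J := J 0 x) (by rw [hJ0]; exact one_pos)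
    have h2 := h1.comp 0 (hJ x).2
    have h3 : HasDerivAt (fun σ => h σ x) (-β (v x / J 0 x) * lapl ζ x) 0 := h2
    rwa [hJ0, div_one] at h3

lemma lapl_cont {d : ℕ} {ζ : EuclideanSpace ℝ (Fin d) → ℝ} (hζ : ContDiff ℝ 2 ζ) :
    Continuous (lapl ζ) := by
  have : lapl ζ = fun x => ∑ i, hessMat ζ x i i := by
    ext x; rw [← hess_trace hζ]; rfl
  rw [this]
  have := hess_cont hζ
  fun_prop

lemma lapl_hcs {d : ℕ} {ζ : EuclideanSpace ℝ (Fin d) → ℝ} (hζ : ContDiff ℝ 2 ζ)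
    (hc : HasCompactSupport ζ) : HasCompactSupport (lapl ζ) := by
  refine (hess_hcs hc).mono ?_
  intro x hx
  contrapose! hx
  simp only [Function.mem_support, not_not] at hx ⊢
  rw [← hess_trace hζ, hx]
  simp [Matrix.trace]

lemma drift_cont {d : ℕ} {ζ Φ : EuclideanSpace ℝ (Fin d) → ℝ} (hζ : ContDiff ℝ 2 ζ)
    (hΦ : ContDiff ℝ 1 Φ) : Continuous (fun x => fderiv ℝ ζ x (gradVec Φ x)) := by
  have h1 : ContDiff ℝ 0 (gradVec Φ) := gradVec_contDiff (n := 0) (by simpa using hΦ)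
  exact (hζ.continuous_fderiv two_ne_zero).clm_apply h1.continuous

lemma drift_hcs {d : ℕ} {ζ : EuclideanSpace ℝ (Fin d) → ℝ} (Φ : EuclideanSpace ℝ (Fin d) → ℝ)
    (hc : HasCompactSupport ζ) : HasCompactSupport (fun x => fderiv ℝ ζ x (gradVec Φ x)) := by
  refine (hc.fderiv (𝕜 := ℝ)).mono ?_
  intro x hx
  contrapose! hx
  simp only [Function.mem_support, not_not] at hx ⊢
  simp [hx]

lemma int_mul_bdd {E : Type*} [MeasurableSpace E] {μ : Measure E} {β : ℝ → ℝ}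
    (hβ : ContDiff ℝ 1 β) (hβ0 : β 0 = 0) {γ γ₁ : ℝ}
    (hγ : 0 < γ) (hβ'_lb : ∀ r, γ ≤ deriv β r) (hβ'_ub : ∀ r, deriv β r ≤ γ₁)
    {v k : E → ℝ} (hv : Measurable v) (hv0 : ∀ x, 0 ≤ v x) (hvi : Integrable v μ)
    (hk : AEStronglyMeasurable k μ) {B : ℝ} (hB : ∀ x, ‖k x‖ ≤ B) :
    Integrable (fun x => β (v x) * k x) μ ∧ Integrable (fun x => v x * k x) μ := by
  have hb : Integrable (fun x => β (v x)) μ := by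
    refine (hvi.const_mul γ₁).mono' (hβ.continuous.measurable.comp hv).aestronglyMeasurable
      (ae_of_all _ fun x => ?_)
    simpa [abs_of_nonneg (hv0 x)] using beta_bound hβ hβ0 hγ hβ'_lb hβ'_ub (v x)
  exact ⟨hb.mul_bdd hk (ae_of_all _ hB), hvi.mul_bdd hk (ae_of_all _ hB)⟩

lemma density_integrable {E : Type*} [MeasureSpace E] {v : E → ℝ} (hv : Measurable v)
    (hv0 : ∀ x, 0 ≤ v x)
    (hp : IsProbabilityMeasure (volume.withDensity fun x => ENNReal.ofReal (v x))) :
    Integrable v ∧ ∫ x, v x = 1 := by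
  have h1 := hp.measure_univ
  rw [withDensity_apply _ MeasurableSet.univ, Measure.restrict_univ] at h1
  have hi : Integrable v := by
    refine ⟨hv.aestronglyMeasurable, ?_⟩
    rw [hasFiniteIntegral_iff_ofReal (ae_of_all _ hv0), h1]
    exact ENNReal.one_lt_top
  refine ⟨hi, ?_⟩
  rw [integral_eq_lintegral_of_nonneg_ae (ae_of_all _ hv0) hv.aestronglyMeasurable, h1]
  simp

lemma energy_deriv {d : ℕ} {β : ℝ → ℝ} (hβ : ContDiff ℝ 1 β) (hβ0 : β 0 = 0) {γ γ₁ : ℝ}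
    (hγ : 0 < γ) (hβ'_lb : ∀ r, γ ≤ deriv β r) (hβ'_ub : ∀ r, deriv β r ≤ γ₁)
    (Φ : EuclideanSpace ℝ (Fin d) → ℝ) (hΦ : ContDiff ℝ 1 Φ)
    (hΦ_grad_bdd : ∃ M : ℝ, ∀ x, ‖fderiv ℝ Φ x‖ ≤ M)
    (ζ : EuclideanSpace ℝ (Fin d) → ℝ) (hζ : ContDiff ℝ 2 ζ) (hζc : HasCompactSupport ζ)
    (v : EuclideanSpace ℝ (Fin d) → ℝ) (hv : Measurable v) (hv0 : ∀ x, 0 ≤ v x)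
    (hp : IsProbabilityMeasure (volume.withDensity fun x => ENNReal.ofReal (v x)))
    (hvl : Integrable (fun x => v x * Real.log (v x)))
    (hvΦ : Integrable (fun x => Φ x * v x)) :
    (∃ ε > (0 : ℝ),
            (∀ σ ∈ Ioo (-ε) ε,
              Integrable (fun x => etaGen β
                (((Measure.map (fun x => x + σ • gradVec ζ x)
                  (volume.withDensity fun x => ENNReal.ofReal (v x))).rnDeriv volume
                    x).toReal)) volume ∧
              Integrable Φ
                (Measure.map (fun x => x + σ • gradVec ζ x)
                  (volume.withDensity fun x => ENNReal.ofReal (v x))))) ∧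
    HasDerivAt (fun σ : ℝ => energyGen β Φ
                (Measure.map (fun x => x + σ • gradVec ζ x)
                  (volume.withDensity fun x => ENNReal.ofReal (v x))))
      (- ∫ x, (β (v x) * lapl ζ x - v x * fderiv ℝ ζ x (gradVec Φ x))) 0 := by
  obtain ⟨hvi, -⟩ := density_integrable hv hv0 hp
  obtain ⟨M, hM⟩ := hΦ_grad_bdd
  have hφ : ContDiff ℝ 1 (gradVec ζ) :=
    gradVec_contDiff (n := 1) (by simpa [one_add_one_eq_two] using hζ)
  have hφc := gradVec_hcs hζc
  obtain ⟨L, hL⟩ := hφ.lipschitzWith_of_hasCompactSupport hφc one_ne_zero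
  obtain ⟨B, hB⟩ := hφc.exists_bound_of_continuous hφ.continuous
  have hvm : Measurable fun x => ENNReal.ofReal (v x) := hv.ennreal_ofReal
  have hΦi : Integrable Φ (volume.withDensity fun x => ENNReal.ofReal (v x)) := by
    rw [integrable_withDensity_iff hvm (ae_of_all _ fun x => ENNReal.ofReal_lt_top)]
    simpa only [ENNReal.toReal_ofReal (hv0 _)] using hvΦ
  obtain ⟨hP, hPd⟩ := potential_part Φ hΦ hM (gradVec ζ) hφ.continuous hB
    (volume.withDensity fun x => ENNReal.ofReal (v x)) hΦi
  obtain ⟨ε, hε, hEi, hEd⟩ := entropy_part hβ hβ0 hγ hβ'_lb hβ'_ub ζ hζ hζc v hv hv0 hvi hvl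
  set δ : ℝ := min ε (1 / (L + 1)) with hδ
  have hδ0 : 0 < δ := by positivity
  have key : ∀ σ ∈ Ioo (-δ) δ,
      Integrable (fun x => etaGen β
                (((Measure.map (fun x => x + σ • gradVec ζ x)
                  (volume.withDensity fun x => ENNReal.ofReal (v x))).rnDeriv volume
                    x).toReal)) volume ∧
      ∫ x, etaGen β
                (((Measure.map (fun x => x + σ • gradVec ζ x)
                  (volume.withDensity fun x => ENNReal.ofReal (v x))).rnDeriv volume
                    x).toReal) =
      ∫ x, detFun σ (hessMat ζ x) * etaGen β (v x / detFun σ (hessMat ζ x)) := by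
    intro σ hσ
    have hσδ : |σ| < δ := abs_lt.2 hσ
    have hσε : σ ∈ Ioo (-ε) ε := abs_lt.1 (hσδ.trans_le (min_le_left _ _))
    have hσL : |σ| * L < 1 := by
      have h1 : |σ| < 1 / (L + 1) := hσδ.trans_le (min_le_right _ _)
      rw [lt_div_iff₀ (by positivity)] at h1
      nlinarith [abs_nonneg σ]
    obtain ⟨T, hT⟩ := homeo_family hL hσL
    have hTf : (fun x => x + σ • gradVec ζ x) = T := by ext1 x; exact (hT x).symm
    have hT' : ∀ x, HasFDerivAt T (ContinuousLinearMap.id ℝ (EuclideanSpace ℝ (Fin d)) +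
        σ • fderiv ℝ (gradVec ζ) x) x := by
      intro x
      rw [← hTf]
      exact (hasFDerivAt_id x).add ((hφ.differentiable one_ne_zero x).hasFDerivAt.const_smul σ)
    have h1 : Continuous (fun m : Fin d → Fin d → ℝ => detFun σ m) :=
      (detFun_contDiff (d := d)).continuous.comp (by fun_prop : Continuous fun m => (σ, m))
    have := pushforward_formula T _ hT' (fun x => by rw [hess_det]; exact (hEi σ hσε).1 x)
      (by simp only [hess_det]; exact (h1.comp (hess_cont hζ)).measurable) v hv hv0 (etaGen β)
    simp only [hess_det] at this
    rw [hTf]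
    exact ⟨this.1.2 (hEi σ hσε).2, this.2⟩
  refine ⟨⟨δ, hδ0, fun σ hσ => ⟨(key σ hσ).1, hP σ⟩⟩, ?_⟩
  have hsum := hEd.add hPd
  have hval : (∫ x, - β (v x) * lapl ζ x) + (∫ x, fderiv ℝ Φ x (gradVec ζ x) ∂
      (volume.withDensity fun x => ENNReal.ofReal (v x))) =
      - ∫ x, (β (v x) * lapl ζ x - v x * fderiv ℝ ζ x (gradVec Φ x)) := by
    rw [integral_withDensity_eq_integral_toReal_smul hvm
      (ae_of_all _ fun x => ENNReal.ofReal_lt_top), ← integral_add, ← integral_neg]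
    · refine integral_congr_ae (ae_of_all _ fun x => ?_)
      simp only [ENNReal.toReal_ofReal (hv0 x), smul_eq_mul]
      rw [fderiv_gradVec_comm]
      ring
    · obtain ⟨B', hB'⟩ := (lapl_hcs hζ hζc).exists_bound_of_continuous (lapl_cont hζ)
      have := (int_mul_bdd hβ hβ0 hγ hβ'_lb hβ'_ub hv hv0 hvi
        (lapl_cont hζ).aestronglyMeasurable hB').1.neg
      refine this.congr (ae_of_all _ fun x => ?_)
      simp
    · obtain ⟨B', hB'⟩ := (drift_hcs Φ hζc).exists_bound_of_continuous (drift_cont hζ hΦ)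
      have := (int_mul_bdd hβ hβ0 hγ hβ'_lb hβ'_ub hv hv0 hvi
        (drift_cont hζ hΦ).aestronglyMeasurable hB').2
      refine this.congr (ae_of_all _ fun x => ?_)
      simp only [ENNReal.toReal_ofReal (hv0 x), smul_eq_mul]
      rw [fderiv_gradVec_comm]
  rw [hval] at hsum
  refine hsum.congr_of_eventuallyEq ?_
  filter_upwards [Ioo_mem_nhds (neg_lt_zero.2 hδ0) hδ0] with σ hσ
  simp only [energyGen, Pi.add_apply]
  rw [(key σ hσ).2]

lemma time_part {d : ℕ} {β : ℝ → ℝ} (hβ : ContDiff ℝ 1 β) (hβ0 : β 0 = 0) {γ γ₁ : ℝ}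
    (hγ : 0 < γ) (hβ'_lb : ∀ r, γ ≤ deriv β r) (hβ'_ub : ∀ r, deriv β r ≤ γ₁)
    (u : ℝ → EuclideanSpace ℝ (Fin d) → ℝ)
    (hu_meas : Measurable (Function.uncurry u))
    (hu_nonneg : ∀ t x, 0 ≤ u t x)
    (hprob : ∀ t : ℝ, 0 < t →
      IsProbabilityMeasure (volume.withDensity fun x => ENNReal.ofReal (u t x))) :
    ∃ N : Set ℝ, volume N = 0 ∧ ∀ t, 0 < t → t ∉ N →
      ∀ p q : EuclideanSpace ℝ (Fin d) → ℝ, Continuous p → Continuous q →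
      HasCompactSupport p → HasCompactSupport q →
      HasDerivAt (fun τ => ∫ r in t..τ, ∫ x, (β (u r x) * p x - u r x * q x))
        (∫ x, (β (u t x) * p x - u t x * q x)) t := by
  have hγ₁ : 0 ≤ γ₁ := hγ.le.trans ((hβ'_lb 0).trans (hβ'_ub 0))
  have hum : ∀ r, Measurable (u r) := fun r => hu_meas.comp measurable_prodMk_left
  have hn : ∀ n : ℕ, ∃ N : Set ℝ, volume N = 0 ∧ ∀ t, 0 < t → t ∉ N →
      ∀ p q : EuclideanSpace ℝ (Fin d) → ℝ, Continuous p → Continuous q →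
      (∀ x ∉ Metric.closedBall 0 (n:ℝ), p x = 0) → (∀ x ∉ Metric.closedBall 0 (n:ℝ), q x = 0) →
      HasDerivAt (fun τ => ∫ r in t..τ, ∫ x, (β (u r x) * p x - u r x * q x))
        (∫ x, (β (u t x) * p x - u t x * q x)) t := by
    intro n
    set K : Set (EuclideanSpace ℝ (Fin d)) := Metric.closedBall 0 (n:ℝ) with hK
    have hKm : MeasurableSet K := Metric.isClosed_closedBall.measurableSet
    have : CompactSpace K := isCompact_iff_compactSpace.1 (isCompact_closedBall _ _)
    let ν : Measure K := Measure.comap Subtype.val volume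
    let X := C(K, ℝ) × C(K, ℝ)
    let G : ℝ → X → ℝ := fun r h => ∫ y : K, (β (u r y) * h.1 y - u r y * h.2 y) ∂ν
    let F : ℝ → X → ℝ := fun r h => if 0 < r then G r h else 0
    have : IsFiniteMeasure ν := by
      refine ⟨?_⟩
      rw [comap_subtype_coe_apply hKm]
      exact lt_of_le_of_lt (measure_mono (Subtype.coe_image_subset _ _))
        (isCompact_closedBall _ _).measure_lt_top
    have huK : ∀ r, 0 < r → Integrable (fun y : K => u r y) ν ∧ ∫ y : K, u r y ∂ν ≤ 1 := by
      intro r hr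
      obtain ⟨h1, h2⟩ := density_integrable (hum r) (hu_nonneg r) (hprob r hr)
      refine ⟨?_, ?_⟩
      · exact (integrableOn_iff_comap_subtypeVal hKm).1 h1.integrableOn
      · have := integral_subtype_comap (μ := volume) hKm (u r)
        rw [this, ← h2]
        exact setIntegral_le_integral h1 (ae_of_all _ (hu_nonneg r))
    have hKi : ∀ r, 0 < r → ∀ f : C(K, ℝ), Integrable (fun y : K => β (u r y) * f y) ν ∧
        Integrable (fun y : K => u r y * f y) ν := by
      intro r hr f
      exact int_mul_bdd hβ hβ0 hγ hβ'_lb hβ'_ub ((hum r).comp measurable_subtype_coe)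
        (fun y => hu_nonneg r y) (huK r hr).1 f.continuous.measurable.aestronglyMeasurable
        (fun y => f.norm_coe_le_norm y)
    have hGL : ∀ r, 0 < r → ∀ h k : X, |G r h - G r k| ≤ (γ₁ + 1) * dist h k := by
      intro r hr h k
      have e1 : G r h - G r k = ∫ y : K, (β (u r y) * (h.1 - k.1) y - u r y * (h.2 - k.2) y) ∂ν := by
        simp only [G]
        have i1 : ∀ l : X, Integrable (fun y : K => β (u r y) * l.1 y - u r y * l.2 y) ν :=
          fun l => (hKi r hr l.1).1.sub (hKi r hr l.2).2
        rw [← integral_sub (i1 h) (i1 k)]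
        refine integral_congr_ae (ae_of_all _ fun y => ?_)
        simp
        ring
      rw [e1]
      have e2 : ∀ y : K, ‖β (u r y) * (h.1 - k.1) y - u r y * (h.2 - k.2) y‖ ≤
          ((γ₁ + 1) * dist h k) * u r y := by
        intro y
        have hb := beta_bound hβ hβ0 hγ hβ'_lb hβ'_ub (u r y)
        rw [abs_of_nonneg (hu_nonneg r y)] at hb
        have b1 : ‖(h.1 - k.1) y‖ ≤ dist h k := by
          refine ((h.1 - k.1).norm_coe_le_norm y).trans ?_
          rw [← dist_eq_norm]; exact le_max_left _ _
        have b2 : ‖(h.2 - k.2) y‖ ≤ dist h k := by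
          refine ((h.2 - k.2).norm_coe_le_norm y).trans ?_
          rw [← dist_eq_norm]; exact le_max_right _ _
        have hu0 := hu_nonneg r y
        calc _ ≤ ‖β (u r y) * (h.1 - k.1) y‖ + ‖u r y * (h.2 - k.2) y‖ := norm_sub_le _ _
          _ = |β (u r y)| * ‖(h.1 - k.1) y‖ + u r y * ‖(h.2 - k.2) y‖ := by
            rw [norm_mul, norm_mul, Real.norm_eq_abs, Real.norm_eq_abs (u r y), abs_of_nonneg hu0]
          _ ≤ (γ₁ * u r y) * dist h k + u r y * dist h k := by gcongr
          _ = _ := by ring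
      have e3 := norm_integral_le_of_norm_le ((huK r hr).1.const_mul ((γ₁ + 1) * dist h k))
        (ae_of_all _ e2)
      rw [integral_const_mul] at e3
      refine e3.trans ?_
      exact mul_le_of_le_one_right (by positivity) (huK r hr).2
    have hFL : ∀ r, ∀ h k : X, |F r h - F r k| ≤ (γ₁ + 1) * dist h k := by
      intro r h k
      by_cases hr : 0 < r
      · simp only [F, if_pos hr]; exact hGL r hr h k
      · simp only [F, if_neg hr, sub_zero, abs_zero]; positivity
    have hF0 : ∀ r, F r 0 = 0 := by intro r; simp [F, G]
    have hFm : ∀ h : X, Measurable (fun r => F r h) := by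
      intro h
      refine Measurable.ite measurableSet_Ioi ?_ measurable_const
      have hu2 : Measurable (fun z : ℝ × K => u z.1 z.2) :=
        hu_meas.comp (measurable_fst.prodMk (measurable_subtype_coe.comp measurable_snd))
      have : Measurable (fun z : ℝ × K => β (u z.1 z.2) * h.1 z.2 - u z.1 z.2 * h.2 z.2) :=
        ((hβ.continuous.measurable.comp hu2).mul
          (h.1.continuous.measurable.comp measurable_snd)).sub
          (hu2.mul (h.2.continuous.measurable.comp measurable_snd))
      exact (this.stronglyMeasurable.integral_prod_right (ν := ν)).measurable
    obtain ⟨N, hN, hd⟩ := lebesgue_common F hFm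
      (fun h => ⟨(γ₁ + 1) * dist h 0, fun r => by simpa [hF0] using hFL r h 0⟩) (γ₁ + 1)
      (by positivity) hFL
    refine ⟨N, hN, fun t ht htN p q hp hq hp0 hq0 => ?_⟩
    let h : X := (⟨fun y => p y, hp.comp continuous_subtype_val⟩,
      ⟨fun y => q y, hq.comp continuous_subtype_val⟩)
    have hG : ∀ r, G r h = ∫ x, (β (u r x) * p x - u r x * q x) := by
      intro r
      have e1 := integral_subtype_comap (μ := volume) hKm (fun x => β (u r x) * p x - u r x * q x)
      have e2 : ∫ x in K, (β (u r x) * p x - u r x * q x) =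
          ∫ x, (β (u r x) * p x - u r x * q x) :=
        setIntegral_eq_integral_of_forall_compl_eq_zero fun x hx => by
          rw [hp0 x hx, hq0 x hx]; simp
      rw [← e2, ← e1]
      rfl
    have h3 := hd t htN h
    have h4 : F t h = ∫ x, (β (u t x) * p x - u t x * q x) := by
      simp only [F, if_pos ht]; exact hG t
    rw [h4] at h3
    refine h3.congr_of_eventuallyEq ?_
    filter_upwards [Ioi_mem_nhds ht] with τ hτ
    refine intervalIntegral.integral_congr fun r hr => ?_
    have hr0 : 0 < r := lt_of_lt_of_le (lt_min ht hτ) hr.1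
    simp only [F, if_pos hr0, hG]
  choose N hN hd using hn
  refine ⟨⋃ n, N n, measure_iUnion_null hN, fun t ht htN p q hp hq hpc hqc => ?_⟩
  simp only [mem_iUnion, not_exists] at htN
  obtain ⟨R, hR⟩ := (hpc.isCompact.union hqc.isCompact).isBounded.subset_closedBall 0
  obtain ⟨n, hn⟩ := exists_nat_ge R
  have hs : ∀ x ∉ Metric.closedBall (0 : EuclideanSpace ℝ (Fin d)) (n:ℝ),
      x ∉ tsupport p ∪ tsupport q := fun x hx hx' =>
    hx (Metric.closedBall_subset_closedBall hn (hR hx'))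
  refine hd n t ht (htN n) p q hp hq (fun x hx => ?_) (fun x hx => ?_)
  · exact image_eq_zero_of_notMem_tsupport fun h => hs x hx (Or.inl h)
  · exact image_eq_zero_of_notMem_tsupport fun h => hs x hx (Or.inr h)

/-- Let `β ∈ C¹(ℝ)` with `β(0) = 0` and `0 < γ ≤ β' ≤ γ₁ < ∞`; let
`Φ ∈ C¹(ℝ^d)` with bounded gradient and `D := −∇Φ`. Let `u ≥ 0` be a bounded
distributional probability solution of `∂_t u = Δβ(u) − div(Du)` in the sense (a)–(d),
with `μ_t := u(t,·)·Leb`. With the energy `E(ρ) := ∫ η(dρ/dLeb) dx + ∫ Φ dρ`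
(`η(r) = ∫₀^r ∫₁^s β'(w)/w dw ds`), there is a Lebesgue-null set `N ⊆ (0,∞)` such that for
every `t ∈ (0,∞)∖N` and every `ζ ∈ C³_c(ℝ^d)`: `τ ↦ ∫ζ dμ_τ` is differentiable at `t`;
there is `ε > 0` such that `E(μ_t∘(Id + σ∇ζ)⁻¹)` is defined and finite (both integrals
exist) for `σ ∈ (−ε,ε)` and is differentiable at `σ = 0`; and
`d/dτ(∫ζ dμ_τ)|_{τ=t} = −d/dσ E(μ_t∘(Id + σ∇ζ)⁻¹)|_{σ=0}`. -/
theorem stmt_18 (d : ℕ)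
    (β : ℝ → ℝ) (hβ : ContDiff ℝ 1 β) (hβ0 : β 0 = 0)
    (γ γ₁ : ℝ) (hγ : 0 < γ)
    (hβ'_lb : ∀ r, γ ≤ deriv β r) (hβ'_ub : ∀ r, deriv β r ≤ γ₁)
    (Φ : EuclideanSpace ℝ (Fin d) → ℝ) (hΦ : ContDiff ℝ 1 Φ)
    (hΦ_grad_bdd : ∃ M : ℝ, ∀ x, ‖fderiv ℝ Φ x‖ ≤ M)
    (u : ℝ → EuclideanSpace ℝ (Fin d) → ℝ)
    (hu_meas : Measurable (Function.uncurry u))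
    (hu_nonneg : ∀ t x, 0 ≤ u t x)
    (hprob : ∀ t : ℝ, 0 < t →
      IsProbabilityMeasure (volume.withDensity fun x => ENNReal.ofReal (u t x)))
    (hu_bdd : ∃ M : ℝ,
      ∀ᵐ p : ℝ × EuclideanSpace ℝ (Fin d) ∂volume, 0 < p.1 → u p.1 p.2 ≤ M)
    (hu_ent : ∀ᵐ t ∂(volume.restrict (Ioi (0 : ℝ))),
      Integrable (fun x => u t x * Real.log (u t x)) volume ∧
      Integrable (fun x => Φ x * u t x) volume)
    (hFPK : ∀ s t : ℝ, 0 < s → s < t →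
      ∀ ζ : EuclideanSpace ℝ (Fin d) → ℝ, ContDiff ℝ 2 ζ → HasCompactSupport ζ →
        (∫ x, ζ x ∂(volume.withDensity fun x => ENNReal.ofReal (u t x))) -
          (∫ x, ζ x ∂(volume.withDensity fun x => ENNReal.ofReal (u s x))) =
          ∫ r in s..t, ∫ x,
            (β (u r x) * lapl ζ x - u r x * fderiv ℝ ζ x (gradVec Φ x))) :
    ∃ N : Set ℝ, N ⊆ Ioi 0 ∧ volume N = 0 ∧
      ∀ t : ℝ, 0 < t → t ∉ N →
        ∀ ζ : EuclideanSpace ℝ (Fin d) → ℝ, ContDiff ℝ 3 ζ → HasCompactSupport ζ →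
          DifferentiableAt ℝ
            (fun τ : ℝ => ∫ x, ζ x ∂(volume.withDensity fun x => ENNReal.ofReal (u τ x))) t ∧
          (∃ ε > (0 : ℝ),
            (∀ σ ∈ Ioo (-ε) ε,
              Integrable (fun x => etaGen β
                (((Measure.map (fun x => x + σ • gradVec ζ x)
                  (volume.withDensity fun x => ENNReal.ofReal (u t x))).rnDeriv volume
                    x).toReal)) volume ∧
              Integrable Φ
                (Measure.map (fun x => x + σ • gradVec ζ x)
                  (volume.withDensity fun x => ENNReal.ofReal (u t x)))) ∧
            DifferentiableAt ℝ
              (fun σ : ℝ => energyGen β Φ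
                (Measure.map (fun x => x + σ • gradVec ζ x)
                  (volume.withDensity fun x => ENNReal.ofReal (u t x)))) 0) ∧
          deriv
            (fun τ : ℝ => ∫ x, ζ x ∂(volume.withDensity fun x => ENNReal.ofReal (u τ x))) t =
          - deriv
            (fun σ : ℝ => energyGen β Φ
              (Measure.map (fun x => x + σ • gradVec ζ x)
                (volume.withDensity fun x => ENNReal.ofReal (u t x)))) 0 := by
  obtain ⟨N₁, hN₁, hd⟩ := time_part hβ hβ0 hγ hβ'_lb hβ'_ub u hu_meas hu_nonneg hprob
  rw [ae_restrict_iff' measurableSet_Ioi] at hu_ent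
  refine ⟨(N₁ ∪ {t | ¬ (t ∈ Ioi (0:ℝ) → Integrable (fun x => u t x * Real.log (u t x)) volume ∧
      Integrable (fun x => Φ x * u t x) volume)}) ∩ Ioi 0, inter_subset_right, ?_, ?_⟩
  · exact measure_mono_null inter_subset_left (measure_union_null hN₁ hu_ent)
  intro t ht htN ζ hζ3 hζc
  have hζ : ContDiff ℝ 2 ζ := hζ3.of_le (by norm_num)
  have ht1 : t ∉ N₁ := fun h => htN ⟨Or.inl h, ht⟩
  have ht2 : Integrable (fun x => u t x * Real.log (u t x)) volume ∧
      Integrable (fun x => Φ x * u t x) volume := by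
    by_contra h
    exact htN ⟨Or.inr fun h' => h (h' ht), ht⟩
  obtain ⟨⟨ε, hε, hi⟩, hE⟩ := energy_deriv hβ hβ0 hγ hβ'_lb hβ'_ub Φ hΦ hΦ_grad_bdd ζ hζ hζc (u t)
    (hu_meas.comp measurable_prodMk_left) (hu_nonneg t) (hprob t ht) ht2.1 ht2.2
  have h1 := hd t ht ht1 (lapl ζ) (fun x => fderiv ℝ ζ x (gradVec Φ x)) (lapl_cont hζ)
    (drift_cont hζ hΦ) (lapl_hcs hζ hζc) (drift_hcs Φ hζc)
  have hT : HasDerivAt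
      (fun τ : ℝ => ∫ x, ζ x ∂(volume.withDensity fun x => ENNReal.ofReal (u τ x)))
      (∫ x, (β (u t x) * lapl ζ x - u t x * fderiv ℝ ζ x (gradVec Φ x))) t := by
    have h2 := h1.const_add (∫ x, ζ x ∂(volume.withDensity fun x => ENNReal.ofReal (u t x)))
    refine h2.congr_of_eventuallyEq ?_
    filter_upwards [Ioi_mem_nhds ht] with τ hτ
    rcases lt_trichotomy τ t with h | h | h
    · have := hFPK τ t hτ h ζ hζ hζc
      rw [intervalIntegral.integral_symm]
      linarith
    · subst h; simp
    · have := hFPK t τ ht h ζ hζ hζc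
      linarith
  refine ⟨hT.differentiableAt, ⟨ε, hε, hi, hE.differentiableAt⟩, ?_⟩
  rw [hT.deriv, hE.deriv, neg_neg]
end
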